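/- Assume k = dim(affine span of K) ∈ {1,…,d−1}, let A_K denote the affine span of K, and let p > 1, δ, δ' ≥ 0 with d − k + min(δ,δ') − p > 0. Then μ_p(ℝ^d \ A_K) ≤ μ_p(ℝ^d \ K); moreover, if δ ≤ δ' then μ_p(ℝ^d \ A_K) = μ_p(ℝ^d \ K). -/

import Mathlib

open MeasureTheory Set

noncomputable section

/-- The optimal Hardy constant `μ_p(Ω_L)` for `Ω_L = ℝ^d \ L` with weight
`c_{Ω_L} = d_L^δ (1+d_L)^(δ'-δ)`. -/
def muP (d : ℕ) (p δ δ' : ℝ) (L : Set (EuclideanSpace ℝ (Fin d))) : ℝ :=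
  sInf { r : ℝ | ∃ φ : EuclideanSpace ℝ (Fin d) → ℝ,
    ContDiff ℝ 1 φ ∧ HasCompactSupport φ ∧ tsupport φ ⊆ Lᶜ ∧ φ ≠ 0 ∧
    r = (∫ x in Lᶜ,
          (Metric.infDist x L ^ δ * (1 + Metric.infDist x L) ^ (δ' - δ)) *
            ‖gradient φ x‖ ^ p) /
        (∫ x in Lᶜ,
          (Metric.infDist x L ^ δ * (1 + Metric.infDist x L) ^ (δ' - δ)) *
            Metric.infDist x L ^ (-p) * |φ x| ^ p) }

section helpers
open Filter Topology

def IsProj {F : Type*} [NormedAddCommGroup F] [InnerProductSpace ℝ F] (K : Set F) (P : F → F) : Prop :=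
  (∀ x, P x ∈ K) ∧ ∀ x, ∀ w ∈ K, inner ℝ (x - P x) (w - P x) ≤ 0

section geom
variable {F : Type*} [NormedAddCommGroup F] [InnerProductSpace ℝ F]

theorem exists_isProj [CompleteSpace F] (K : Set F) (hne : K.Nonempty) (hcl : IsClosed K)
    (hconv : Convex ℝ K) : ∃ P : F → F, IsProj K P := by
  have h : ∀ x : F, ∃ v ∈ K, ∀ w ∈ K, inner ℝ (x - v) (w - v) ≤ 0 := by
    intro x
    obtain ⟨v, hv, h⟩ := exists_norm_eq_iInf_of_complete_convex hne hcl.isComplete hconv x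
    exact ⟨v, hv, (norm_eq_iInf_iff_real_inner_le_zero hconv hv).1 h⟩
  choose P h1 h2 using h
  exact ⟨P, h1, h2⟩

theorem IsProj.mono {K : Set F} {P : F → F} (hP : IsProj K P) (x y : F) :
    0 ≤ inner ℝ (P x - P y) ((x - P x) - (y - P y)) := by
  have h1 := hP.2 x (P y) (hP.1 y)
  have h2 := hP.2 y (P x) (hP.1 x)
  have e1 : inner ℝ (x - P x) (P y - P x) = - inner ℝ (P x - P y) (x - P x) := by
    rw [← neg_sub (P x) (P y), inner_neg_right, real_inner_comm]
  rw [e1] at h1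
  rw [real_inner_comm] at h2
  rw [inner_sub_right]
  linarith

theorem IsProj.sq_le {K : Set F} {P : F → F} (hP : IsProj K P) (x y : F) :
    ‖P x - P y‖ ^ 2 ≤ inner ℝ (P x - P y) (x - y) := by
  have h := hP.mono x y
  have e : (x - P x) - (y - P y) = (x - y) - (P x - P y) := by abel
  rw [e, inner_sub_right, real_inner_self_eq_norm_sq] at h
  linarith

theorem IsProj.unique {K : Set F} {P : F → F} (hP : IsProj K P) {x v : F} (hv : v ∈ K)
    (h : ∀ w ∈ K, inner ℝ (x - v) (w - v) ≤ 0) : P x = v := by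
  have h1 := hP.2 x v hv
  have h2 := h (P x) (hP.1 x)
  have : ‖v - P x‖ ^ 2 ≤ 0 := by
    rw [← real_inner_self_eq_norm_sq]
    have e : inner ℝ (v - P x) (v - P x) = inner ℝ (x - P x) (v - P x) + inner ℝ (x - v) (P x - v) := by
      rw [← neg_sub v (P x), inner_neg_right, ← sub_eq_add_neg, ← inner_sub_left]
      congr 1
      abel
    linarith
  have h3 : ‖v - P x‖ = 0 := by nlinarith [norm_nonneg (v - P x)]
  exact (sub_eq_zero.1 (norm_eq_zero.1 h3)).symm

theorem IsProj.infDist {K : Set F} {P : F → F} (hP : IsProj K P) (x : F) :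
    Metric.infDist x K = ‖x - P x‖ := by
  apply le_antisymm
  · rw [← dist_eq_norm]; exact Metric.infDist_le_dist_of_mem (hP.1 x)
  · rw [Metric.le_infDist ⟨_, hP.1 x⟩]
    intro w hw
    rw [dist_eq_norm]
    have h := hP.2 x w hw
    have e : x - w = (x - P x) - (w - P x) := by abel
    have : ‖x - P x‖^2 ≤ ‖x - w‖^2 := by
      rw [e, norm_sub_sq_real (x - P x)]
      nlinarith [sq_nonneg ‖w - P x‖]
    exact (abs_le_of_sq_le_sq' this (norm_nonneg _)).2

theorem IsProj.lip {K : Set F} {P : F → F} (hP : IsProj K P) (x y : F) :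
    ‖P x - P y‖ ≤ ‖x - y‖ := by
  have h := hP.sq_le x y
  have h2 := real_inner_le_norm (P x - P y) (x - y)
  by_contra hc
  push Not at hc
  nlinarith [norm_nonneg (x - y), norm_nonneg (P x - P y)]

theorem IsProj.continuous {K : Set F} {P : F → F} (hP : IsProj K P) : Continuous P := by
  have : LipschitzWith 1 P := LipschitzWith.of_dist_le_mul (fun x y => by
    simpa [dist_eq_norm] using hP.lip x y)
  exact this.continuous

/-- the dilation -/
def dil (P : F → F) (a : ℝ) (x : F) : F := P x + a • (x - P x)

theorem IsProj.proj_dil {K : Set F} {P : F → F} (hP : IsProj K P) {a : ℝ} (ha : 0 ≤ a) (x : F) :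
    P (dil P a x) = P x := by
  apply hP.unique (hP.1 x)
  intro w hw
  have := hP.2 x w hw
  rw [dil, add_sub_cancel_left, inner_smul_left]
  exact mul_nonpos_of_nonneg_of_nonpos ha this

theorem IsProj.dil_dil {K : Set F} {P : F → F} (hP : IsProj K P) {a b : ℝ} (ha : 0 ≤ a) (x : F) :
    dil P b (dil P a x) = dil P (b * a) x := by
  conv_lhs => rw [dil, hP.proj_dil ha]
  rw [dil, dil, add_sub_cancel_left, smul_smul]

theorem dil_one (P : F → F) (x : F) : dil P 1 x = x := by simp [dil]

theorem IsProj.infDist_dil {K : Set F} {P : F → F} (hP : IsProj K P) {a : ℝ} (ha : 0 ≤ a) (x : F) :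
    Metric.infDist (dil P a x) K = a * Metric.infDist x K := by
  rw [hP.infDist, hP.infDist, hP.proj_dil ha, dil, add_sub_cancel_left, norm_smul,
    Real.norm_of_nonneg ha]

theorem IsProj.continuous_dil {K : Set F} {P : F → F} (hP : IsProj K P) (a : ℝ) :
    Continuous (dil P a) := by
  have := hP.continuous
  unfold dil
  fun_prop

theorem lip_aux [FiniteDimensional ℝ F] {K : Set F} {P : F → F} (hP : IsProj K P) (V : Submodule ℝ F)
    (hV : ∀ x ∈ K, ∀ y ∈ K, x - y ∈ V) (x y : F) :
    ‖(P x + Vᗮ.starProjection x) - (P y + Vᗮ.starProjection y)‖ ≤ ‖x - y‖ := by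
  set q := Vᗮ.starProjection with hq
  have hv := hV _ (hP.1 x) _ (hP.1 y)
  have e : (P x + q x) - (P y + q y) = (P x - P y) + q (x - y) := by rw [map_sub]; abel
  have hqm : q (x - y) ∈ Vᗮ := Submodule.starProjection_apply_mem _ _
  have o1 : inner ℝ (P x - P y) (q (x - y)) = 0 := Submodule.inner_right_of_mem_orthogonal hv hqm
  have o2 : inner ℝ ((x - y) - q (x - y)) (q (x - y)) = 0 := by
    have : (x - y) - q (x - y) ∈ Vᗮᗮ := Submodule.sub_starProjection_mem_orthogonal _
    exact Submodule.inner_left_of_mem_orthogonal hqm this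
  have h := hP.sq_le x y
  have h' : ‖P x - P y‖ ^ 2 ≤ inner ℝ (P x - P y) ((x - y) - q (x - y)) := by
    rw [inner_sub_right, o1]; simpa using h
  have h2 := real_inner_le_norm (P x - P y) ((x - y) - q (x - y))
  have h3 : ‖P x - P y‖ ≤ ‖(x - y) - q (x - y)‖ := by
    by_contra hc
    push Not at hc
    nlinarith [norm_nonneg ((x - y) - q (x - y)), norm_nonneg (P x - P y)]
  rw [e]
  have n1 : ‖P x - P y + q (x - y)‖ ^ 2 = ‖P x - P y‖^2 + ‖q (x-y)‖^2 := by
    rw [norm_add_sq_real, o1]; ring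
  have n2 : ‖x - y‖ ^ 2 = ‖(x - y) - q (x - y)‖^2 + ‖q (x-y)‖^2 := by
    conv_lhs => rw [← sub_add_cancel (x - y) (q (x - y)), norm_add_sq_real, o2]
    ring
  have : ‖P x - P y + q (x - y)‖ ^ 2 ≤ ‖x - y‖^2 := by
    rw [n1, n2]; gcongr
  exact (abs_le_of_sq_le_sq' this (norm_nonneg _)).2

theorem det_aux [FiniteDimensional ℝ F] (V : Submodule ℝ F) (l : ℝ) :
    LinearMap.det ((LinearMap.id : F →ₗ[ℝ] F) - (1 - l) • (Vᗮ.starProjection : F →ₗ[ℝ] F))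
      = l ^ (Module.finrank ℝ Vᗮ) := by
  have hc : IsCompl V Vᗮ := Submodule.isCompl_orthogonal V
  set e := Submodule.prodEquivOfIsCompl V Vᗮ hc
  have : (LinearMap.id : F →ₗ[ℝ] F) - (1 - l) • (Vᗮ.starProjection : F →ₗ[ℝ] F)
    = (e : (V × Vᗮ) →ₗ[ℝ] F) ∘ₗ
      (LinearMap.prodMap (LinearMap.id : V →ₗ[ℝ] V) (l • (LinearMap.id : Vᗮ →ₗ[ℝ] Vᗮ))) ∘ₗ (e.symm : F →ₗ[ℝ] (V × Vᗮ)) := by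
    apply LinearMap.ext
    intro x
    obtain ⟨⟨v, w⟩, rfl⟩ := e.surjective x
    have h1 : Vᗮ.starProjection (v : F) = 0 := by
      rw [Submodule.starProjection_apply_eq_zero_iff]
      simp
    have h2 : Vᗮ.starProjection (w : F) = w := by
      rw [Submodule.starProjection_eq_self_iff]; exact w.2
    have h3 : V.starProjection (w : F) = 0 := by
      rw [Submodule.starProjection_apply_eq_zero_iff]; exact w.2
    simp [e, h3, sub_smul]
    abel
  rw [this, LinearMap.det_conj, LinearMap.det_prodMap]
  simp [LinearMap.det_smul]

variable [FiniteDimensional ℝ F] [MeasurableSpace F] [BorelSpace F]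

theorem lip_vol (μ : Measure F) [μ.IsAddHaarMeasure] (R : F → F) (hR : LipschitzWith 1 R) (s : Set F) :
    μ (R '' s) ≤ μ s := by
  have h := hR.hausdorffMeasure_image_le (d := (Module.finrank ℝ F)) (by positivity) s
  have e := Measure.isAddLeftInvariant_eq_smul μ (μH[(Module.finrank ℝ F : ℝ)] : Measure F)
  rw [e]
  simp only [Measure.smul_apply]
  simp at h
  gcongr

theorem vol_dil_image (μ : Measure F) [μ.IsAddHaarMeasure] {K : Set F} {P : F → F} (hP : IsProj K P)
    (V : Submodule ℝ F)
    (hV : ∀ x ∈ K, ∀ y ∈ K, x - y ∈ V) (l : ℝ) (hl : 0 ≤ l) (hl1 : l ≤ 1) (s : Set F) :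
    μ (dil P l '' s) ≤ ENNReal.ofReal (l ^ (Module.finrank ℝ Vᗮ)) * μ s := by
  rcases s.eq_empty_or_nonempty with rfl | ⟨x0, hx0⟩
  · simp
  set q := Vᗮ.starProjection with hq
  set D := (LinearMap.id : F →ₗ[ℝ] F) - (1 - l) • (q : F →ₗ[ℝ] F) with hD
  set R : F → F := fun x => (1 - l) • (P x + q x) + l • x with hR
  have hRL : LipschitzWith 1 R := by
    apply LipschitzWith.of_dist_le_mul
    intro x y
    rw [dist_eq_norm, dist_eq_norm]
    have := lip_aux hP V hV x y
    have e : R x - R y = (1 - l) • ((P x + q x) - (P y + q y)) + l • (x - y) := by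
      simp only [hR, smul_sub]; abel
    rw [e]
    calc _ ≤ _ := norm_add_le _ _
      _ = (1-l) * ‖(P x + q x) - (P y + q y)‖ + l * ‖x - y‖ := by
        rw [norm_smul, norm_smul, Real.norm_of_nonneg hl, Real.norm_of_nonneg (by linarith)]
      _ ≤ (1-l) * ‖x - y‖ + l * ‖x - y‖ := by
        have : 0 ≤ 1 - l := by linarith
        gcongr
      _ = _ := by simp; ring
  have key : ∀ x, dil P l x = ((1 - l) * (1 - l)) • q (P x0) + D (R x) := by
    intro x
    have hv := hV _ (hP.1 x) _ (hP.1 x0)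
    have h0 : q (P x) = q (P x0) := by
      have : q (P x - P x0) = 0 := by
        rw [hq, Submodule.starProjection_apply_eq_zero_iff]; simpa using hv
      rw [map_sub, sub_eq_zero] at this; exact this
    have hqq : q (q x) = q x := by
      rw [hq, Submodule.starProjection_eq_self_iff]; exact Submodule.starProjection_apply_mem _ _
    simp only [hD, hR, dil, LinearMap.sub_apply, LinearMap.id_apply, LinearMap.smul_apply,
      ContinuousLinearMap.coe_coe, map_add, map_smul, hqq, h0]
    module
  have : dil P l '' s = (fun y => ((1 - l) * (1 - l)) • q (P x0) + y) '' (D '' (R '' s)) := by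
    rw [image_image, image_image]
    exact image_congr (fun x _ => key x)
  rw [this, image_add_left, measure_preimage_add, Measure.addHaar_image_linearMap, det_aux, abs_of_nonneg (by positivity)]
  exact mul_le_mul_right (lip_vol μ R hRL s) _

theorem map_dil_le (μ : Measure F) [μ.IsAddHaarMeasure] {K : Set F} {P : F → F} (hP : IsProj K P)
    (V : Submodule ℝ F)
    (hV : ∀ x ∈ K, ∀ y ∈ K, x - y ∈ V) (a : ℝ) (ha : 1 ≤ a) :
    μ.map (dil P a) ≤ ENNReal.ofReal ((a⁻¹) ^ (Module.finrank ℝ Vᗮ)) • μ := by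
  rw [Measure.le_iff]
  intro s hs
  rw [Measure.map_apply (hP.continuous_dil a).measurable hs]
  have : dil P a ⁻¹' s ⊆ dil P a⁻¹ '' s := by
    intro x hx
    refine ⟨_, hx, ?_⟩
    rw [hP.dil_dil (by linarith), inv_mul_cancel₀ (by linarith), dil_one]
  refine (measure_mono this).trans ?_
  exact vol_dil_image μ hP V hV a⁻¹ (by positivity) (inv_le_one_of_one_le₀ ha) s

theorem integral_dil_le (μ : Measure F) [μ.IsAddHaarMeasure] {K : Set F} {P : F → F} (hP : IsProj K P)
    (V : Submodule ℝ F)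
    (hV : ∀ x ∈ K, ∀ y ∈ K, x - y ∈ V) (a : ℝ) (ha : 1 ≤ a) (g : F → ℝ) (hg : Integrable g μ)
    (hgc : Continuous g) (hg0 : ∀ x, 0 ≤ g x) :
    ∫ x, g (dil P a x) ∂μ ≤ (a⁻¹) ^ (Module.finrank ℝ Vᗮ) * ∫ x, g x ∂μ := by
  have h1 : ∫ x, g (dil P a x) ∂μ = ∫ x, g x ∂(μ.map (dil P a)) := by
    rw [integral_map (hP.continuous_dil a).measurable.aemeasurable hgc.aestronglyMeasurable]
  have h2 := integral_mono_measure (map_dil_le μ hP V hV a ha) (f := g) (Filter.Eventually.of_forall hg0)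
    (hg.smul_measure (by simp))
  rw [h1]
  refine h2.trans (le_of_eq ?_)
  rw [integral_smul_measure, ENNReal.toReal_ofReal (by positivity), smul_eq_mul]

end geom



theorem weight_scale (p δ δ' s a : ℝ) (hs : 0 < s) (ha : 1 ≤ a) :
    s ^ δ * (1 + s) ^ (δ' - δ) * s ^ (-p) ≤
      a ^ (-(min δ δ' - p)) * ((a * s) ^ δ * (1 + a * s) ^ (δ' - δ) * (a * s) ^ (-p)) := by
  have ha0 : 0 < a := by linarith
  have e1 : (a * s) ^ δ = a ^ δ * s ^ δ := Real.mul_rpow ha0.le hs.le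
  have e2 : (a * s) ^ (-p) = a ^ (-p) * s ^ (-p) := Real.mul_rpow ha0.le hs.le
  have key : (1 + s) ^ (δ' - δ) ≤ a ^ (-(min δ δ' - p)) * a ^ δ * a ^ (-p) * (1 + a * s) ^ (δ' - δ) := by
    rw [← Real.rpow_add ha0, ← Real.rpow_add ha0]
    rcases le_total δ δ' with h | h
    · rw [min_eq_left h]
      have : -(δ - p) + δ + -p = 0 := by ring
      rw [this, Real.rpow_zero, one_mul]
      apply Real.rpow_le_rpow (by linarith) _ (by linarith)
      nlinarith
    · rw [min_eq_right h]
      have : -(δ' - p) + δ + -p = -(δ' - δ) := by ring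
      rw [this, Real.rpow_neg ha0.le, ← div_eq_inv_mul, ← Real.div_rpow (by positivity) ha0.le]
      apply Real.rpow_le_rpow_of_nonpos (by positivity) _ (by linarith)
      rw [div_le_iff₀ ha0]
      nlinarith
  rw [e1, e2]
  have h3 : 0 ≤ s ^ δ * s ^ (-p) := by positivity
  calc _ = (s ^ δ * s ^ (-p)) * (1 + s) ^ (δ' - δ) := by ring
    _ ≤ (s ^ δ * s ^ (-p)) * _ := mul_le_mul_of_nonneg_left key h3
    _ = _ := by ring

theorem add_rpow_split (p l u v : ℝ) (hp : 1 ≤ p) (hl : 0 < l) (hl1 : l < 1) (hu : 0 ≤ u) (hv : 0 ≤ v) :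
    (u + v) ^ p ≤ l ^ (1 - p) * u ^ p + (1 - l) ^ (1 - p) * v ^ p := by
  have hm : 0 < 1 - l := by linarith
  have h := (convexOn_rpow hp).2 (x := u / l) (y := v / (1 - l)) (by simp; positivity) (by simp; positivity)
    hl.le hm.le (by ring)
  simp only [smul_eq_mul] at h
  rw [mul_div_cancel₀ _ hl.ne', mul_div_cancel₀ _ hm.ne', Real.div_rpow hu hl.le, Real.div_rpow hv hm.le] at h
  rw [Real.rpow_sub hl, Real.rpow_sub hm, Real.rpow_one, Real.rpow_one]
  refine h.trans (le_of_eq ?_)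
  ring

section hardy
variable {F : Type*} [NormedAddCommGroup F] [InnerProductSpace ℝ F]

/-- weight -/
def WW (p δ δ' : ℝ) (K : Set F) (x : F) : ℝ :=
  (Metric.infDist x K ^ δ * (1 + Metric.infDist x K) ^ (δ' - δ)) * Metric.infDist x K ^ (-p)

theorem WW_nonneg (p δ δ' : ℝ) (K : Set F) (x : F) : 0 ≤ WW p δ δ' K x := by
  have : 0 ≤ Metric.infDist x K := Metric.infDist_nonneg
  unfold WW; positivity

theorem infDist_pos' {K : Set F} (hne : K.Nonempty) (hcl : IsClosed K) {x : F} (hx : x ∉ K) :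
    0 < Metric.infDist x K := (hcl.notMem_iff_infDist_pos hne).1 hx

theorem WW_pos (p δ δ' : ℝ) {K : Set F} (hne : K.Nonempty) (hcl : IsClosed K) {x : F} (hx : x ∉ K) :
    0 < WW p δ δ' K x := by
  have := infDist_pos' hne hcl hx
  unfold WW; positivity

theorem WW_cont (p δ δ' : ℝ) {K : Set F} (hne : K.Nonempty) (hcl : IsClosed K) :
    ContinuousOn (WW p δ δ' K) Kᶜ := by
  have hd : ContinuousOn (fun x => Metric.infDist x K) Kᶜ := (Metric.continuous_infDist_pt K).continuousOn
  have h1 : ∀ x ∈ Kᶜ, Metric.infDist x K ≠ 0 := fun x hx => (infDist_pos' hne hcl hx).ne'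
  have h2 : ∀ x ∈ Kᶜ, 1 + Metric.infDist x K ≠ 0 := fun x hx => by
    have := infDist_pos' hne hcl hx
    positivity
  unfold WW
  exact ((hd.rpow_const (fun x hx => Or.inl (h1 x hx))).mul
    ((continuousOn_const.add hd).rpow_const (fun x hx => Or.inl (h2 x hx)))).mul
    (hd.rpow_const (fun x hx => Or.inl (h1 x hx)))

theorem good_mul {K : Set F} (hcl : IsClosed K) {w G : F → ℝ} (hw : ContinuousOn w Kᶜ)
    (hG : Continuous G) {S : Set F} (hS : IsCompact S) (hSK : S ⊆ Kᶜ) (h0 : ∀ x, x ∉ S → G x = 0) :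
    Continuous (fun x => w x * G x) ∧ HasCompactSupport (fun x => w x * G x) := by
  have h1 : HasCompactSupport (fun x => w x * G x) :=
    HasCompactSupport.intro hS (fun x hx => by rw [h0 x hx, mul_zero])
  refine ⟨?_, h1⟩
  apply ContinuousOn.continuous_of_tsupport_subset (s := Kᶜ) (hw.mul hG.continuousOn) hcl.isOpen_compl
  refine Subset.trans ?_ hSK
  apply closure_minimal _ hS.isClosed
  intro x hx
  by_contra hc
  exact hx (by simp [h0 x hc])

variable [FiniteDimensional ℝ F] [MeasurableSpace F] [BorelSpace F]

theorem hardy_step (μ : Measure F) [μ.IsAddHaarMeasure] {K : Set F} (hcl : IsClosed K) (hne : K.Nonempty)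
    {P : F → F} (hP : IsProj K P)
    (V : Submodule ℝ F) (hV : ∀ x ∈ K, ∀ y ∈ K, x - y ∈ V) (a : ℝ) (ha : 1 < a)
    (p δ δ' C : ℝ) (hp : 1 < p) (hC : C * p = Module.finrank ℝ Vᗮ + min δ δ' - p) (hC0 : 0 < C)
    (φ : F → ℝ) (hφ : Continuous φ) (hφc : HasCompactSupport φ) (hφs : tsupport φ ⊆ Kᶜ) :
    (1 - a ^ (-C)) ^ p * ∫ x, WW p δ δ' K x * |φ x| ^ p ∂μ ≤
      ∫ x, WW p δ δ' K x * |φ x - φ (dil P a x)| ^ p ∂μ := by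
  have hp0 : 0 < p := by linarith
  have ha0 : 0 < a := by linarith
  set S0 := tsupport φ
  have hS0 : IsCompact S0 := hφc
  set S1 := dil P a⁻¹ '' S0
  have hS1 : IsCompact S1 := hS0.image (hP.continuous_dil _)
  have hdK : ∀ b : ℝ, 0 < b → ∀ x, x ∉ K → dil P b x ∉ K := by
    intro b hb x hx hc
    have h1 := hP.infDist_dil hb.le x
    rw [Metric.infDist_zero_of_mem hc] at h1
    have := infDist_pos' hne hcl hx
    have : 0 < b * Metric.infDist x K := by positivity
    linarith
  have hS1K : S1 ⊆ Kᶜ := by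
    rintro _ ⟨x, hx, rfl⟩
    exact hdK _ (by positivity) x (hφs hx)
  have hψ0 : ∀ x, x ∉ S1 → φ (dil P a x) = 0 := by
    intro x hx
    by_contra hc
    apply hx
    refine ⟨dil P a x, subset_tsupport _ hc, ?_⟩
    rw [hP.dil_dil ha0.le, inv_mul_cancel₀ ha0.ne', dil_one]
  have hφ0 : ∀ x, x ∉ S0 → φ x = 0 := fun x hx => image_eq_zero_of_notMem_tsupport hx
  have hψ : Continuous (fun x => φ (dil P a x)) := hφ.comp (hP.continuous_dil a)
  have hWc := WW_cont p δ δ' hne hcl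
  have z0 : (0:ℝ) ^ p = 0 := Real.zero_rpow hp0.ne'
  have c1 := good_mul hcl hWc (G := fun x => |φ x| ^ p) (hφ.abs.rpow_const (fun x => Or.inr hp0.le)) hS0 hφs
    (fun x hx => by rw [hφ0 x hx, abs_zero, z0])
  have c2 := good_mul hcl hWc (G := fun x => |φ (dil P a x)| ^ p) (hψ.abs.rpow_const (fun x => Or.inr hp0.le)) hS1 hS1K
    (fun x hx => by rw [hψ0 x hx, abs_zero, z0])
  have c3 := good_mul hcl hWc (G := fun x => |φ x - φ (dil P a x)| ^ p)
    ((hφ.sub hψ).abs.rpow_const (fun x => Or.inr hp0.le)) (hS0.union hS1) (union_subset hφs hS1K)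
    (fun x hx => by
      rw [hφ0 x (fun h => hx (Or.inl h)), hψ0 x (fun h => hx (Or.inr h)), sub_zero, abs_zero, z0])
  have i1 : Integrable _ μ := c1.1.integrable_of_hasCompactSupport c1.2
  have i2 : Integrable _ μ := c2.1.integrable_of_hasCompactSupport c2.2
  have i3 : Integrable _ μ := c3.1.integrable_of_hasCompactSupport c3.2
  set J := ∫ x, WW p δ δ' K x * |φ x| ^ p ∂μ
  -- step A
  have i4 : Integrable (fun x => WW p δ δ' K (dil P a x) * |φ (dil P a x)| ^ p) μ := by
    have hcc : Continuous (fun x => WW p δ δ' K (dil P a x) * |φ (dil P a x)| ^ p) :=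
      c1.1.comp (hP.continuous_dil a)
    apply hcc.integrable_of_hasCompactSupport
    exact HasCompactSupport.intro hS1 (fun x hx => by rw [hψ0 x hx, abs_zero, z0, mul_zero])
  have A1 : ∫ x, WW p δ δ' K x * |φ (dil P a x)| ^ p ∂μ ≤
      a ^ (-(min δ δ' - p)) * ∫ x, WW p δ δ' K (dil P a x) * |φ (dil P a x)| ^ p ∂μ := by
    rw [← integral_const_mul]
    apply integral_mono i2 (i4.const_mul _)
    intro x
    by_cases hx : x ∈ S1
    · have hd := infDist_pos' hne hcl (hS1K hx)
      have := weight_scale p δ δ' _ a hd ha.le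
      simp only
      rw [← mul_assoc]
      apply mul_le_mul_of_nonneg_right _ (by positivity)
      unfold WW
      rw [hP.infDist_dil ha0.le]
      exact this
    · simp only [hψ0 x hx, abs_zero, z0, mul_zero, le_refl]
  have A2 := integral_dil_le μ hP V hV a ha.le (fun x => WW p δ δ' K x * |φ x| ^ p) i1 c1.1
    (fun x => mul_nonneg (WW_nonneg _ _ _ _ _) (by positivity))
  set l := a ^ (-C) with hl
  have hl0 : 0 < l := by positivity
  have hl1 : l < 1 := Real.rpow_lt_one_of_one_lt_of_neg ha (by linarith)
  have A3 : ∫ x, WW p δ δ' K x * |φ (dil P a x)| ^ p ∂μ ≤ l ^ p * J := by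
    refine A1.trans ?_
    have : l ^ p = a ^ (-(min δ δ' - p)) * (a⁻¹) ^ (Module.finrank ℝ Vᗮ) := by
      rw [hl, ← Real.rpow_mul ha0.le, inv_pow, ← Real.rpow_natCast, ← Real.rpow_neg ha0.le, ← Real.rpow_add ha0]
      congr 1
      linarith
    rw [this, mul_assoc]
    exact mul_le_mul_of_nonneg_left A2 (by positivity)
  have hm : 0 < 1 - l := by linarith
  have B : J ≤ l ^ (1 - p) * (∫ x, WW p δ δ' K x * |φ (dil P a x)| ^ p ∂μ) +
      (1 - l) ^ (1 - p) * ∫ x, WW p δ δ' K x * |φ x - φ (dil P a x)| ^ p ∂μ := by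
    rw [← integral_const_mul, ← integral_const_mul, ← integral_add (i2.const_mul _) (i3.const_mul _)]
    apply integral_mono i1 ((i2.const_mul _).add (i3.const_mul _))
    intro x
    have h1 : |φ x| ≤ |φ (dil P a x)| + |φ x - φ (dil P a x)| := by
      have := abs_add_le (φ (dil P a x)) (φ x - φ (dil P a x))
      simpa using this
    have h2 := (Real.rpow_le_rpow (abs_nonneg _) h1 hp0.le).trans
      (add_rpow_split p l _ _ hp.le hl0 hl1 (abs_nonneg _) (abs_nonneg _))
    have h3 := mul_le_mul_of_nonneg_left h2 (WW_nonneg p δ δ' K x)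
    refine h3.trans (le_of_eq ?_)
    simp only [Pi.add_apply]
    ring
  set Q := ∫ x, WW p δ δ' K x * |φ x - φ (dil P a x)| ^ p ∂μ
  have B2 : J ≤ l * J + (1 - l) ^ (1 - p) * Q := by
    refine B.trans ?_
    have : l * J = l ^ (1 - p) * (l ^ p * J) := by
      rw [← mul_assoc, ← Real.rpow_add hl0]; simp
    rw [this]
    gcongr
  have B3 : (1 - l) * J ≤ (1 - l) ^ (1 - p) * Q := by linarith
  have e1 : (1 - l) ^ p = (1 - l) ^ (p - 1) * (1 - l) := by
    rw [← Real.rpow_add_one hm.ne']; simp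
  rw [e1, mul_assoc]
  have B4 := mul_le_mul_of_nonneg_left B3 (Real.rpow_nonneg hm.le (p - 1))
  refine B4.trans (le_of_eq ?_)
  rw [← mul_assoc, ← Real.rpow_add hm]; simp

end hardy

section hardy2
variable {F : Type*} [NormedAddCommGroup F] [InnerProductSpace ℝ F]
variable [FiniteDimensional ℝ F] [MeasurableSpace F] [BorelSpace F]

theorem tendsto_aux (C : ℝ) : Tendsto (fun n : ℕ => (1 - (1 + 1 / ((n:ℝ) + 1)) ^ (-C)) / (1 / ((n:ℝ) + 1)))
    atTop (𝓝 C) := by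
  have h : HasDerivAt (fun x : ℝ => x ^ (-C)) (-C * 1 ^ (-C - 1)) 1 :=
    Real.hasDerivAt_rpow_const (Or.inl one_ne_zero)
  rw [Real.one_rpow, mul_one, hasDerivAt_iff_tendsto_slope_zero] at h
  have h2 : Tendsto (fun n : ℕ => 1 / ((n:ℝ) + 1)) atTop (𝓝[≠] 0) := by
    rw [tendsto_nhdsWithin_iff]
    refine ⟨tendsto_one_div_add_atTop_nhds_zero_nat, Eventually.of_forall (fun n => ?_)⟩
    simp; positivity
  have h3 := (h.comp h2).neg
  rw [neg_neg] at h3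
  refine h3.congr (fun n => ?_)
  simp only [Function.comp, smul_eq_mul, Real.one_rpow]
  rw [div_eq_inv_mul]; ring

theorem hardy_lower [CompleteSpace F] (μ : Measure F) [μ.IsAddHaarMeasure] {K : Set F} (hcl : IsClosed K) (hne : K.Nonempty)
    {P : F → F} (hP : IsProj K P)
    (V : Submodule ℝ F) (hV : ∀ x ∈ K, ∀ y ∈ K, x - y ∈ V)
    (p δ δ' C : ℝ) (hp : 1 < p) (hC : C * p = Module.finrank ℝ Vᗮ + min δ δ' - p) (hC0 : 0 < C)
    (φ : F → ℝ) (hφ : ContDiff ℝ 1 φ) (hφc : HasCompactSupport φ) (hφs : tsupport φ ⊆ Kᶜ) :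
    C ^ p * ∫ x, WW p δ δ' K x * |φ x| ^ p ∂μ ≤
      ∫ x, (Metric.infDist x K ^ δ * (1 + Metric.infDist x K) ^ (δ' - δ)) * ‖gradient φ x‖ ^ p ∂μ := by
  have hp0 : 0 < p := by linarith
  have z0 : (0:ℝ) ^ p = 0 := Real.zero_rpow hp0.ne'
  set a : ℕ → ℝ := fun n => 1 + 1 / ((n:ℝ) + 1) with ha
  have ha1 : ∀ n, 1 < a n := fun n => by
    have : 0 < 1 / ((n:ℝ) + 1) := by positivity
    simp only [ha]; linarith
  have ha2 : ∀ n, a n ≤ 2 := fun n => by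
    have : 1 / ((n:ℝ) + 1) ≤ 1 := by
      rw [div_le_one (by positivity)]; linarith [(Nat.cast_nonneg n : (0:ℝ) ≤ n)]
    simp only [ha]; linarith
  obtain ⟨L, hL⟩ := ContDiff.lipschitzWith_of_hasCompactSupport hφc hφ (by simp)
  set S : Set F := (fun q : ℝ × F => dil P q.1 q.2) '' (Icc (1/2) 1 ×ˢ tsupport φ) with hS
  have hSc : IsCompact S := by
    apply (isCompact_Icc.prod hφc).image
    have := hP.continuous
    unfold dil
    fun_prop
  have hSK : S ⊆ Kᶜ := by
    rintro _ ⟨⟨b, x⟩, ⟨hb, hx⟩, rfl⟩ hc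
    simp only [mem_Icc] at hb hx hc
    have hb0 : 0 < b := by linarith [hb.1]
    have h1 := hP.infDist_dil hb0.le x
    rw [Metric.infDist_zero_of_mem hc] at h1
    have := infDist_pos' hne hcl (hφs hx)
    have : 0 < b * Metric.infDist x K := by positivity
    linarith
  have hS0 : ∀ n x, x ∉ S → φ (dil P (a n) x) = 0 := by
    intro n x hx
    by_contra hc
    apply hx
    have h0 : 0 < a n := by linarith [ha1 n]
    refine ⟨((a n)⁻¹, dil P (a n) x), ⟨⟨?_, ?_⟩, subset_tsupport _ hc⟩, ?_⟩
    · simp only; rw [one_div]; gcongr; exact ha2 n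
    · exact inv_le_one_of_one_le₀ (ha1 n).le
    · simp only
      rw [hP.dil_dil h0.le, inv_mul_cancel₀ h0.ne', dil_one]
  have hS0' : ∀ x, x ∉ S → φ x = 0 := by
    intro x hx
    by_contra hc
    exact hx ⟨(1, x), ⟨⟨by norm_num, le_refl _⟩, subset_tsupport _ hc⟩, dil_one P x⟩
  have hWc := WW_cont p δ δ' hne hcl
  have hφC : Continuous φ := hφ.continuous
  set Fn : ℕ → F → ℝ := fun n x => WW p δ δ' K x * |(φ x - φ (dil P (a n) x)) / (a n - 1)| ^ p with hFn
  have hdil : ∀ n x, dil P (a n) x = x + (1 / ((n:ℝ) + 1)) • (x - P x) := by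
    intro n x
    simp only [dil, ha]
    module
  have lim : Tendsto (fun n => ∫ x, Fn n x ∂μ) atTop
      (𝓝 (∫ x, WW p δ δ' K x * |fderiv ℝ φ x (x - P x)| ^ p ∂μ)) := by
    apply tendsto_integral_of_dominated_convergence
      (S.indicator (fun x => WW p δ δ' K x * (L * ‖x - P x‖) ^ p))
    · intro n
      have c := good_mul hcl hWc (G := fun x => |(φ x - φ (dil P (a n) x)) / (a n - 1)| ^ p)
        (by
          have := hP.continuous_dil (a n)
          exact ((hφC.sub (hφC.comp this)).div_const _).abs.rpow_const (fun x => Or.inr hp0.le))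
        hSc hSK (fun x hx => by rw [hS0 n x hx, hS0' x hx]; simp [z0])
      exact c.1.aestronglyMeasurable
    · rw [integrable_indicator_iff hSc.measurableSet]
      apply ContinuousOn.integrableOn_compact hSc
      apply (hWc.mono hSK).mul
      apply Continuous.continuousOn
      have := hP.continuous
      apply Continuous.rpow_const (by fun_prop)
      intro x; exact Or.inr hp0.le
    · intro n
      filter_upwards with x
      by_cases hx : x ∈ S
      · rw [indicator_of_mem hx, Real.norm_of_nonneg (mul_nonneg (WW_nonneg _ _ _ _ _) (by positivity))]
        apply mul_le_mul_of_nonneg_left _ (WW_nonneg _ _ _ _ _)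
        apply Real.rpow_le_rpow (abs_nonneg _) _ hp0.le
        have h1 := hL.dist_le_mul x (dil P (a n) x)
        have hpos : 0 < a n - 1 := by linarith [ha1 n]
        rw [abs_div, abs_of_pos hpos, div_le_iff₀ hpos]
        rw [Real.dist_eq, dist_eq_norm] at h1
        refine h1.trans (le_of_eq ?_)
        rw [hdil, sub_add_cancel_left, norm_neg, norm_smul, Real.norm_of_nonneg (by positivity)]
        simp only [ha]
        ring
      · rw [indicator_of_notMem hx]
        simp [hFn, hS0 n x hx, hS0' x hx, z0]
    · filter_upwards with x
      apply Tendsto.const_mul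
      apply Tendsto.rpow_const _ (Or.inr hp0.le)
      have hd : HasFDerivAt φ (fderiv ℝ φ x) x := (hφ.differentiable (by simp) x).hasFDerivAt
      have h1 := hd.hasLineDerivAt (x - P x)
      have h2 := h1.tendsto_slope_zero
      have h3 : Tendsto (fun n : ℕ => 1 / ((n:ℝ) + 1)) atTop (𝓝[≠] 0) := by
        rw [tendsto_nhdsWithin_iff]
        refine ⟨tendsto_one_div_add_atTop_nhds_zero_nat, Eventually.of_forall (fun n => ?_)⟩
        simp; positivity
      refine ((h2.comp h3).abs).congr (fun n => ?_)
      simp only [Function.comp, smul_eq_mul]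
      rw [← hdil, ← div_eq_inv_mul, abs_div, abs_div, abs_sub_comm]
      simp [ha]
  have step : ∀ n, ((1 - (a n) ^ (-C)) / (1 / ((n:ℝ) + 1))) ^ p * ∫ x, WW p δ δ' K x * |φ x| ^ p ∂μ
      ≤ ∫ x, Fn n x ∂μ := by
    intro n
    have h := hardy_step μ hcl hne hP V hV (a n) (ha1 n) p δ δ' C hp hC hC0 φ hφC hφc hφs
    have hpos : 0 < 1 / ((n:ℝ) + 1) := by positivity
    have hl : 0 ≤ 1 - a n ^ (-C) := by
      have := Real.rpow_lt_one_of_one_lt_of_neg (ha1 n) (neg_neg_of_pos hC0)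
      linarith
    rw [Real.div_rpow hl hpos.le, div_mul_eq_mul_div, div_le_iff₀ (by positivity), ← integral_mul_const]
    refine h.trans (le_of_eq ?_)
    congr 1
    ext x
    have e : a n - 1 = 1 / ((n:ℝ) + 1) := by simp [ha]
    simp only [hFn, e]
    rw [abs_div, abs_of_pos hpos, Real.div_rpow (abs_nonneg _) hpos.le]
    field_simp
  have l2 : Tendsto (fun n => ((1 - (a n) ^ (-C)) / (1 / ((n:ℝ) + 1))) ^ p * ∫ x, WW p δ δ' K x * |φ x| ^ p ∂μ)
      atTop (𝓝 (C ^ p * ∫ x, WW p δ δ' K x * |φ x| ^ p ∂μ)) :=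
    ((tendsto_aux C).rpow_const (Or.inr hp0.le)).mul_const _
  refine (le_of_tendsto_of_tendsto' l2 lim step).trans ?_
  have hfd : Continuous (fderiv ℝ φ) := hφ.continuous_fderiv (by simp)
  have hgr : ∀ x, ‖gradient φ x‖ = ‖fderiv ℝ φ x‖ := fun x => by
    simp [gradient]
  have hf0 : ∀ x, x ∉ tsupport φ → fderiv ℝ φ x = 0 := fun x hx => by
    by_contra hc
    exact hx (support_fderiv_subset ℝ hc)
  have c1 := good_mul hcl hWc (G := fun x => |fderiv ℝ φ x (x - P x)| ^ p)
        (by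
          have := hP.continuous
          apply Continuous.rpow_const _ (fun x => Or.inr hp0.le)
          fun_prop)
        hφc hφs (fun x hx => by rw [hf0 x hx]; simp [z0])
  have hcC : ContinuousOn (fun x => Metric.infDist x K ^ δ * (1 + Metric.infDist x K) ^ (δ' - δ)) Kᶜ := by
    have := WW_cont 0 δ δ' hne hcl
    exact this.congr (fun x _ => by simp [WW])
  have c2 := good_mul hcl hcC (G := fun x => ‖gradient φ x‖ ^ p)
        (by
          simp only [hgr]
          apply Continuous.rpow_const _ (fun x => Or.inr hp0.le)
          fun_prop)
        hφc hφs (fun x hx => by rw [hgr, hf0 x hx]; simp [z0])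
  apply integral_mono (c1.1.integrable_of_hasCompactSupport c1.2) (c2.1.integrable_of_hasCompactSupport c2.2)
  intro x
  by_cases hx : x ∈ tsupport φ
  · have hd := infDist_pos' hne hcl (hφs hx)
    have h1 : |fderiv ℝ φ x (x - P x)| ≤ ‖fderiv ℝ φ x‖ * Metric.infDist x K := by
      rw [hP.infDist]; exact (fderiv ℝ φ x).le_opNorm _
    have h2 := Real.rpow_le_rpow (abs_nonneg _) h1 hp0.le
    rw [Real.mul_rpow (norm_nonneg _) hd.le] at h2
    have h3 := mul_le_mul_of_nonneg_left h2 (WW_nonneg p δ δ' K x)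
    refine h3.trans (le_of_eq ?_)
    simp only [WW, hgr]
    have : Metric.infDist x K ^ (-p) * Metric.infDist x K ^ p = 1 := by
      rw [← Real.rpow_add hd]; simp
    linear_combination (Metric.infDist x K ^ δ * (1 + Metric.infDist x K) ^ (δ' - δ)) * ‖fderiv ℝ φ x‖ ^ p * this
  · simp [hgr, hf0 x hx, z0]

end hardy2


theorem integral_log_sub (g : ℝ → ℝ) : ∫ s in Ioi (0:ℝ), s⁻¹ * g (Real.log s) = ∫ t, g t := by
  have h := integral_image_eq_integral_abs_deriv_smul (s := (univ : Set ℝ)) (f := Real.exp) (f' := Real.exp)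
    MeasurableSet.univ (fun x _ => (Real.hasDerivAt_exp x).hasDerivWithinAt) Real.exp_injective.injOn
    (fun s => s⁻¹ * g (Real.log s))
  rw [image_univ, Real.range_exp] at h
  rw [h, Measure.restrict_univ]
  congr 1
  ext t
  rw [abs_of_pos (Real.exp_pos t), Real.log_exp, smul_eq_mul, ← mul_assoc, mul_inv_cancel₀ (Real.exp_pos t).ne', one_mul]

theorem integral_log_eps (g : ℝ → ℝ) (ε : ℝ) (hε : 0 < ε) :
    ∫ s in Ioi (0:ℝ), s⁻¹ * g (ε * Real.log s) = ε⁻¹ * ∫ t, g t := by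
  rw [integral_log_sub (fun t => g (ε * t)), Measure.integral_comp_mul_left]
  rw [abs_of_pos (by positivity), smul_eq_mul]

theorem comb_int {X : Type*} [MeasurableSpace X] {μ : Measure X} (t l a b e : ℝ) {g1 g2 g3 : X → ℝ}
    (h1 : Integrable g1 μ) (h2 : Integrable g2 μ) (h3 : Integrable g3 μ) :
    Integrable (fun x => t * (l * (a * g1 x + b * g2 x) + e * g3 x)) μ ∧
    ∫ x, t * (l * (a * g1 x + b * g2 x) + e * g3 x) ∂μ =
      t * (l * (a * ∫ x, g1 x ∂μ + b * ∫ x, g2 x ∂μ) + e * ∫ x, g3 x ∂μ) := by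
  have i1 : Integrable (fun x => a * g1 x) μ := h1.const_mul a
  have i2 : Integrable (fun x => b * g2 x) μ := h2.const_mul b
  have i3 : Integrable (fun x => e * g3 x) μ := h3.const_mul e
  have i4 : Integrable (fun x => a * g1 x + b * g2 x) μ := i1.add i2
  have i5 : Integrable (fun x => l * (a * g1 x + b * g2 x)) μ := i4.const_mul l
  have i6 : Integrable (fun x => l * (a * g1 x + b * g2 x) + e * g3 x) μ := i5.add i3
  refine ⟨i6.const_mul t, ?_⟩
  rw [integral_const_mul, integral_add i5 i3, integral_const_mul, integral_add i1 i2,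
    integral_const_mul, integral_const_mul, integral_const_mul]

section upper
variable {F : Type*} [NormedAddCommGroup F] [InnerProductSpace ℝ F]
variable [FiniteDimensional ℝ F] [MeasurableSpace F] [BorelSpace F]

theorem prod_formula (μ : Measure F) [μ.IsAddHaarMeasure] (V : Submodule ℝ F) [Nontrivial Vᗮ] (x0 : F) :
    ∃ κ : ℝ, 0 < κ ∧ ∀ (α : F → ℝ) (β : ℝ → ℝ),
      ∫ x, α (V.starProjection (x - x0)) * β ‖Vᗮ.starProjection (x - x0)‖ ∂μ =
        κ * (∫ v : V, α v ∂(Measure.addHaar : Measure V)) *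
          ∫ s in Ioi (0:ℝ), s ^ (Module.finrank ℝ Vᗮ - 1) * β s := by
  have hc : IsCompl V Vᗮ := Submodule.isCompl_orthogonal V
  set e := (Submodule.prodEquivOfIsCompl V Vᗮ hc).toContinuousLinearEquiv with he
  set ν : Measure (V × Vᗮ) := (Measure.addHaar : Measure V).prod (Measure.addHaar : Measure Vᗮ) with hν
  have hmap : Measure.IsAddHaarMeasure (μ.map e.symm) := by
    exact e.symm.isAddHaarMeasure_map μ
  obtain ⟨k, hk0, hk⟩ : ∃ k : ℝ, 0 < k ∧ ∀ f : V × Vᗮ → ℝ, ∫ q, f q ∂(μ.map e.symm) = k * ∫ q, f q ∂ν := by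
    have h1 := Measure.isAddLeftInvariant_eq_smul (μ.map e.symm) ν
    refine ⟨((μ.map e.symm).addHaarScalarFactor ν : ℝ), ?_, fun f => ?_⟩
    · exact_mod_cast Measure.addHaarScalarFactor_pos_of_isAddHaarMeasure _ _
    · conv_lhs => rw [h1, integral_smul_nnreal_measure]
      exact rfl
  set m := Module.finrank ℝ Vᗮ
  have hb : 0 < (Measure.addHaar : Measure Vᗮ).real (Metric.ball 0 1) := by
    rw [Measure.real, ENNReal.toReal_pos_iff]
    exact ⟨Metric.measure_ball_pos _ _ one_pos, measure_ball_lt_top⟩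
  have hm : 0 < m := Module.finrank_pos
  refine ⟨k * (m * (Measure.addHaar : Measure Vᗮ).real (Metric.ball 0 1)), by positivity, fun α β => ?_⟩
  rw [integral_sub_right_eq_self (fun x => α (V.starProjection x) * β ‖Vᗮ.starProjection x‖) x0]
  have h2 : ∫ x, α (V.starProjection x) * β ‖Vᗮ.starProjection x‖ ∂μ =
      ∫ q : V × Vᗮ, α q.1 * β ‖q.2‖ ∂(μ.map e.symm) := by
    have hi := e.symm.toHomeomorph.measurableEmbedding.integral_map (μ := μ) (fun q : V × Vᗮ => α q.1 * β ‖q.2‖)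
    refine Eq.trans ?_ hi.symm
    congr 1
    ext x
    obtain ⟨⟨v, w⟩, rfl⟩ := e.surjective x
    have h1 : Vᗮ.starProjection (v : F) = 0 := by
      rw [Submodule.starProjection_apply_eq_zero_iff]
      simp
    have h2 : Vᗮ.starProjection (w : F) = w := by
      rw [Submodule.starProjection_eq_self_iff]; exact w.2
    have h3 : V.starProjection (w : F) = 0 := by
      rw [Submodule.starProjection_apply_eq_zero_iff]; exact w.2
    have h4 : V.starProjection (v : F) = v := by
      rw [Submodule.starProjection_eq_self_iff]; exact v.2
    have h5 : e (v, w) = (v : F) + w := by simp [he]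
    have h6 : e.symm.toHomeomorph (e (v, w)) = (v, w) := e.symm_apply_apply _
    rw [h6, h5, map_add, map_add, h1, h2, h3, h4]
    simp
  rw [h2, hk, hν, integral_prod_mul (fun v : V => α v) (fun w : Vᗮ => β ‖w‖), integral_fun_norm_addHaar]
  simp only [smul_eq_mul, nsmul_eq_mul]
  ring

theorem good_cont {f : F → ℝ} {U S : Set F} (hU : IsOpen U) (hf : ContinuousOn f U) (hS : IsCompact S)
    (hSU : S ⊆ U) (h0 : ∀ x, x ∉ S → f x = 0) : Continuous f ∧ HasCompactSupport f := by
  refine ⟨?_, HasCompactSupport.intro hS h0⟩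
  apply ContinuousOn.continuous_of_tsupport_subset hf hU
  refine Subset.trans ?_ hSU
  apply closure_minimal _ hS.isClosed
  intro x hx
  by_contra hc
  exact hx (h0 x hc)


set_option maxHeartbeats 2000000 in
theorem upper_test [CompleteSpace F] (μ : Measure F) [μ.IsAddHaarMeasure] (V : Submodule ℝ F) [Nontrivial Vᗮ] (x0 : F)
    (b : F → ℝ) (hb : ContDiff ℝ 1 b) (hb0 : ∀ x, 0 ≤ b x) (hb1 : b 0 ≠ 0) (hbs : ∀ x, 2 < ‖x‖ → b x = 0)
    (h : ℝ → ℝ) (hh : ContDiff ℝ 1 h) (hh0 : ∀ u, 0 ≤ h u) (u0 u1 u2 : ℝ) (hu0 : h u0 ≠ 0)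
    (hhs : ∀ u, u ∉ Icc u1 u2 → h u = 0) (h00 : (0:ℝ) ∉ Icc u1 u2)
    (ε R l p σ C θ Θ : ℝ) (hε : 0 < ε) (hR : 0 < R) (hl : 0 < l) (hl1 : l < 1) (hp : 1 < p)
    (c : ℝ → ℝ) (hc : ContinuousOn c (Ioi 0)) (hc0 : ∀ s, 0 ≤ s → 0 ≤ c s) (hθ : 0 < θ) (hΘ : 0 ≤ Θ)
    (hc1 : ∀ s, 0 < s → Real.exp (u1 / ε) ≤ s → s ≤ Real.exp (u2 / ε) → θ * s ^ σ ≤ c s)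
    (hc2 : ∀ s, 0 < s → Real.exp (u1 / ε) ≤ s → s ≤ Real.exp (u2 / ε) → c s ≤ Θ * s ^ σ)
    (hC : C * p = Module.finrank ℝ Vᗮ + σ - p) (hC0 : 0 < C) :
    ∃ φ : F → ℝ, ContDiff ℝ 1 φ ∧ HasCompactSupport φ ∧
      (∀ x ∈ tsupport φ, ‖V.starProjection (x - x0)‖ ≤ 2 * R ∧ 0 < ‖Vᗮ.starProjection (x - x0)‖) ∧
      φ ≠ 0 ∧ 0 < ∫ x, c ‖Vᗮ.starProjection (x - x0)‖ * ‖Vᗮ.starProjection (x - x0)‖ ^ (-p) * |φ x| ^ p ∂μ ∧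
      ∫ x, c ‖Vᗮ.starProjection (x - x0)‖ * ‖gradient φ x‖ ^ p ∂μ ≤
        (Θ / θ * (l ^ (1 - p) * (l ^ (1 - p) * C ^ p + (1 - l) ^ (1 - p) * ε ^ p * ((∫ u, |deriv h u| ^ p) / (∫ u, h u ^ p)))
          + (1 - l) ^ (1 - p) * (Real.exp (u2 / ε) / R) ^ p *
            ((∫ v : V, ‖fderiv ℝ b v‖ ^ p ∂(Measure.addHaar : Measure V)) / (∫ v : V, b v ^ p ∂(Measure.addHaar : Measure V))))) *
        ∫ x, c ‖Vᗮ.starProjection (x - x0)‖ * ‖Vᗮ.starProjection (x - x0)‖ ^ (-p) * |φ x| ^ p ∂μ := by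
  have hp0 : 0 < p := by linarith
  have z0 : (0:ℝ) ^ p = 0 := Real.zero_rpow hp0.ne'
  obtain ⟨κ, hκ, hprod⟩ := prod_formula μ V x0
  set y : F → F := fun x => V.starProjection (x - x0) with hy
  set z : F → F := fun x => Vᗮ.starProjection (x - x0) with hz
  have hyc : Continuous y := by fun_prop
  have hzc : Continuous z := by fun_prop
  set s1 := Real.exp (u1 / ε) with hs1
  set s2 := Real.exp (u2 / ε) with hs2
  have hs1p : 0 < s1 := Real.exp_pos _
  have hs2p : 0 < s2 := Real.exp_pos _
  set S : Set F := {x | ‖y x‖ ≤ 2 * R ∧ s1 ≤ ‖z x‖ ∧ ‖z x‖ ≤ s2} with hS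
  set U : Set F := {x | z x ≠ 0} with hU
  have hUo : IsOpen U := isOpen_ne_fun hzc continuous_const
  have hSU : S ⊆ U := by
    rintro x ⟨_, h1, _⟩ h2
    rw [h2, norm_zero] at h1; linarith
  have hyz : ∀ x, x - x0 = y x + z x := fun x => by
    simp only [hy, hz]
    rw [Submodule.starProjection_orthogonal_val]; abel
  have hScl : IsClosed S := by
    apply IsClosed.inter
    · exact isClosed_le hyc.norm continuous_const
    · exact (isClosed_le continuous_const hzc.norm).inter (isClosed_le hzc.norm continuous_const)
  have hSc : IsCompact S := by
    apply Metric.isCompact_of_isClosed_isBounded hScl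
    apply (Metric.isBounded_closedBall (x := x0) (r := 2 * R + s2)).subset
    rintro x ⟨h1, _, h2⟩
    rw [mem_closedBall_iff_norm, hyz]
    exact (norm_add_le _ _).trans (by linarith)
  -- vanishing facts
  have hlog : ∀ s, 0 ≤ s → ¬ (s1 ≤ s ∧ s ≤ s2) → ε * Real.log s ∉ Icc u1 u2 := by
    intro s hs hns hmem
    rcases hs.eq_or_lt with rfl | hs
    · rw [Real.log_zero, mul_zero] at hmem; exact h00 hmem
    · apply hns
      constructor
      · rw [hs1, ← Real.le_log_iff_exp_le hs, div_le_iff₀ hε]; linarith [hmem.1]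
      · rw [hs2, ← Real.log_le_iff_le_exp hs, le_div_iff₀ hε]; linarith [hmem.2]
  have hd0 : ∀ u, u ∉ Icc u1 u2 → deriv h u = 0 := by
    intro u hu
    have : h =ᶠ[𝓝 u] fun _ => 0 := by
      filter_upwards [isClosed_Icc.isOpen_compl.mem_nhds hu] with v hv using hhs v hv
    rw [this.deriv_eq]; simp
  have hdb0 : ∀ v : F, 2 < ‖v‖ → fderiv ℝ b v = 0 := by
    intro v hv
    have : b =ᶠ[𝓝 v] fun _ => 0 := by
      filter_upwards [(isOpen_lt continuous_const continuous_norm).mem_nhds hv] with w hw using hbs w hw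
    rw [this.fderiv_eq]; simp
  have hRv : ∀ v : F, ¬ ‖v‖ ≤ 2 * R → 2 < ‖R⁻¹ • v‖ := by
    intro v hv
    push Not at hv
    rw [norm_smul, norm_inv, Real.norm_of_nonneg hR.le, ← div_eq_inv_mul, lt_div_iff₀ hR]
    exact hv
  set f : ℝ → ℝ := fun s => s ^ (-C) * h (ε * Real.log s) with hf
  set φ : F → ℝ := fun x => b (R⁻¹ • y x) * f ‖z x‖ with hφ
  have hA0 : ∀ x, x ∉ S → ¬ ‖y x‖ ≤ 2 * R ∨ ¬ (s1 ≤ ‖z x‖ ∧ ‖z x‖ ≤ s2) := by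
    intro x hx
    by_contra hcon
    push Not at hcon
    exact hx hcon
  have hφ0 : ∀ x, x ∉ S → φ x = 0 := by
    intro x hx
    rcases hA0 x hx with h1 | h1
    · simp only [hφ]; rw [hbs _ (hRv _ h1), zero_mul]
    · simp only [hφ, hf]; rw [hhs _ (hlog _ (norm_nonneg _) h1)]; simp
  have hts : tsupport φ ⊆ S := by
    apply closure_minimal _ hScl
    intro x hx
    by_contra hcon
    exact hx (hφ0 x hcon)
  -- derivatives
  have hf' : ∀ s, 0 < s → HasDerivAt f (s ^ (-C - 1) * (-C * h (ε * Real.log s) + ε * deriv h (ε * Real.log s))) s := by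
    intro s hs
    have d1 : HasDerivAt (fun s : ℝ => s ^ (-C)) (-C * s ^ (-C - 1)) s := Real.hasDerivAt_rpow_const (Or.inl hs.ne')
    have d2 : HasDerivAt (fun s : ℝ => ε * Real.log s) (ε * s⁻¹) s := (Real.hasDerivAt_log hs.ne').const_mul ε
    have d3 : HasDerivAt h (deriv h (ε * Real.log s)) (ε * Real.log s) :=
      (hh.differentiable (by simp) _).hasDerivAt
    have d4 := d1.mul (d3.comp s d2)
    refine d4.congr_deriv ?_
    simp only [Function.comp]
    have : s ^ (-C) = s ^ (-C - 1) * s := by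
      rw [← Real.rpow_add_one hs.ne']; simp
    rw [this]
    field_simp
  have hzn : ∀ x ∈ U, ContDiffAt ℝ 1 (fun x => ‖z x‖) x := by
    intro x hx
    apply ContDiffAt.norm ℝ _ hx
    apply ContDiff.contDiffAt
    fun_prop
  have hfU : ∀ x ∈ U, ContDiffAt ℝ 1 (fun x => f ‖z x‖) x := by
    intro x hx
    have hpos : ‖z x‖ ≠ 0 := norm_ne_zero_iff.2 hx
    have g1 : ContDiffAt ℝ 1 (fun x => ‖z x‖ ^ (-C)) x := (hzn x hx).rpow_const_of_ne hpos
    have g2 : ContDiffAt ℝ 1 (fun x => ε * Real.log ‖z x‖) x := contDiffAt_const.mul ((hzn x hx).log hpos)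
    exact g1.mul (hh.contDiffAt.comp x g2)
  have hbC : ContDiff ℝ 1 (fun x => b (R⁻¹ • y x)) := by
    apply hb.comp
    fun_prop
  have hφC : ContDiff ℝ 1 φ := by
    rw [contDiff_iff_contDiffAt]
    intro x
    by_cases hx : x ∈ S
    · exact hbC.contDiffAt.mul (hfU x (hSU hx))
    · have : φ =ᶠ[𝓝 x] fun _ => 0 := by
        filter_upwards [hScl.isOpen_compl.mem_nhds hx] with w hw using hφ0 w hw
      exact contDiffAt_const.congr_of_eventuallyEq this
  have hgr : ∀ x, ‖gradient φ x‖ = ‖fderiv ℝ φ x‖ := fun x => by simp [gradient]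
  have hfd0 : ∀ x, x ∉ S → fderiv ℝ φ x = 0 := fun x hx => by
    by_contra hcon
    exact hx (hts (support_fderiv_subset ℝ hcon))
  have hVn : ∀ W : Submodule ℝ F, ∀ x, ‖W.starProjection x‖ ≤ ‖x‖ := fun W x => Submodule.norm_starProjection_apply_le W x
  have grad_bd : ∀ x ∈ S, ‖fderiv ℝ φ x‖ ≤ b (R⁻¹ • y x) *
      (‖z x‖ ^ (-C - 1) * (C * h (ε * Real.log ‖z x‖) + ε * |deriv h (ε * Real.log ‖z x‖)|))
      + R⁻¹ * ‖fderiv ℝ b (R⁻¹ • y x)‖ * f ‖z x‖ := by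
    intro x hx
    have hxU := hSU hx
    have hpos : 0 < ‖z x‖ := norm_pos_iff.2 hxU
    have e1 : DifferentiableAt ℝ (fun x => ‖z x‖) x := (hzn x hxU).differentiableAt (by simp)
    have e2 := (hf' _ hpos).comp_hasFDerivAt x e1.hasFDerivAt
    have e3 : ‖fderiv ℝ (fun x => ‖z x‖) x‖ ≤ 1 := by
      have : LipschitzWith 1 (fun x => ‖z x‖) := by
        apply LipschitzWith.of_dist_le_mul
        intro x x'
        rw [Real.dist_eq, dist_eq_norm]
        refine (abs_norm_sub_norm_le _ _).trans ?_
        have : z x - z x' = Vᗮ.starProjection (x - x') := by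
          simp only [hz]; rw [← map_sub]; congr 1; abel
        rw [this]
        simpa using hVn Vᗮ (x - x')
      simpa using norm_fderiv_le_of_lipschitz ℝ this (x₀ := x)
    have e4 : HasFDerivAt (fun x => R⁻¹ • y x) (R⁻¹ • V.starProjection) x := by
      have : HasFDerivAt y V.starProjection x := by
        exact (V.starProjection.hasFDerivAt).comp x ((hasFDerivAt_id x).sub_const x0)
      exact this.const_smul _
    have e5 := ((hb.differentiable (by simp) (R⁻¹ • y x)).hasFDerivAt).comp x e4
    have e6 : fderiv ℝ φ x = _ := (e5.mul e2).fderiv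
    rw [e6]
    refine (norm_add_le _ _).trans ?_
    rw [norm_smul, norm_smul, norm_smul]
    simp only [Function.comp]
    have t0 : 0 ≤ h (ε * Real.log ‖z x‖) := hh0 _
    have tf : 0 ≤ f ‖z x‖ := by simp only [hf]; positivity
    rw [Real.norm_of_nonneg (hb0 _), Real.norm_of_nonneg tf]
    have t1 : ‖‖z x‖ ^ (-C - 1) * (-C * h (ε * Real.log ‖z x‖) + ε * deriv h (ε * Real.log ‖z x‖))‖
       ≤ ‖z x‖ ^ (-C - 1) * (C * h (ε * Real.log ‖z x‖) + ε * |deriv h (ε * Real.log ‖z x‖)|) := by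
      rw [norm_mul, Real.norm_of_nonneg (by positivity)]
      apply mul_le_mul_of_nonneg_left _ (by positivity)
      refine (norm_add_le _ _).trans (le_of_eq ?_)
      rw [norm_mul, norm_mul, norm_neg, Real.norm_of_nonneg hC0.le, Real.norm_of_nonneg t0, Real.norm_of_nonneg hε.le,
        Real.norm_eq_abs]
    have t2 : ‖(fderiv ℝ b (R⁻¹ • y x)).comp (R⁻¹ • V.starProjection)‖ ≤ R⁻¹ * ‖fderiv ℝ b (R⁻¹ • y x)‖ := by
      refine (ContinuousLinearMap.opNorm_comp_le _ _).trans ?_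
      rw [norm_smul, norm_inv, Real.norm_of_nonneg hR.le]
      have : ‖V.starProjection‖ ≤ 1 := Submodule.starProjection_norm_le V
      calc _ ≤ ‖fderiv ℝ b (R⁻¹ • y x)‖ * (R⁻¹ * 1) := by gcongr
        _ = _ := by ring
    have t3 : 0 ≤ ‖z x‖ ^ (-C - 1) * (C * h (ε * Real.log ‖z x‖) + ε * |deriv h (ε * Real.log ‖z x‖)|) := by positivity
    apply add_le_add
    · apply mul_le_mul_of_nonneg_left _ (hb0 _)
      calc _ ≤ _ * 1 := mul_le_mul t1 e3 (norm_nonneg _) t3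
        _ = _ := mul_one _
    · calc _ ≤ f ‖z x‖ * (R⁻¹ * ‖fderiv ℝ b (R⁻¹ • y x)‖) := mul_le_mul_of_nonneg_left t2 tf
        _ = _ := by ring
  set m := Module.finrank ℝ Vᗮ with hm
  have hm1 : 1 ≤ m := Module.finrank_pos
  set k := Module.finrank ℝ V with hk
  have hI : ∀ (α : F → ℝ) (g : ℝ → ℝ), ∫ x, α (R⁻¹ • y x) * (‖z x‖ ^ (-(m:ℝ)) * g (ε * Real.log ‖z x‖)) ∂μ =
      (κ * R ^ k * ε⁻¹) * (∫ v : V, α v ∂(Measure.addHaar : Measure V)) * ∫ u, g u := by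
    intro α g
    have := hprod (fun v => α (R⁻¹ • v)) (fun s => s ^ (-(m:ℝ)) * g (ε * Real.log s))
    refine this.trans ?_
    have i1 : ∫ v : V, α (R⁻¹ • (v : F)) ∂(Measure.addHaar : Measure V) =
        R ^ k * ∫ v : V, α v ∂(Measure.addHaar : Measure V) := by
      have := Measure.integral_comp_inv_smul (Measure.addHaar : Measure V) (fun v : V => α v) R
      rw [abs_of_pos (by positivity), smul_eq_mul] at this
      exact this
    have i2 : ∫ s in Ioi (0:ℝ), s ^ (m - 1) * (s ^ (-(m:ℝ)) * g (ε * Real.log s)) = ε⁻¹ * ∫ u, g u := by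
      rw [← integral_log_eps g ε hε]
      apply setIntegral_congr_fun measurableSet_Ioi
      intro s hs
      have hs : 0 < s := hs
      simp only
      rw [← mul_assoc]
      congr 1
      rw [← Real.rpow_natCast, ← Real.rpow_add hs, ← Real.rpow_neg_one]
      congr 1
      rw [Nat.cast_sub hm1]; push_cast; ring
    rw [i1, i2]
    ring
  have hX1 : 0 < ∫ v : V, b v ^ p ∂(Measure.addHaar : Measure V) := by
    apply Continuous.integral_pos_of_hasCompactSupport_nonneg_nonzero (x := 0)
    · have := hb.continuous
      exact (this.comp continuous_subtype_val).rpow_const (fun x => Or.inr hp0.le)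
    · apply HasCompactSupport.intro (isCompact_closedBall (0 : V) 2)
      intro v hv
      have : 2 < ‖(v : F)‖ := by simpa using hv
      rw [hbs _ this, z0]
    · intro v; exact Real.rpow_nonneg (hb0 _) _
    · have : 0 < b 0 := lt_of_le_of_ne (hb0 0) (Ne.symm hb1)
      simp only [Submodule.coe_zero]
      positivity
  have hH1 : 0 < ∫ u, h u ^ p := by
    apply Continuous.integral_pos_of_hasCompactSupport_nonneg_nonzero (x := u0)
    · exact hh.continuous.rpow_const (fun x => Or.inr hp0.le)
    · apply HasCompactSupport.intro (isCompact_Icc (a := u1) (b := u2))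
      intro v hv
      rw [hhs _ hv, z0]
    · intro v; exact Real.rpow_nonneg (hh0 _) _
    · have : 0 < h u0 := lt_of_le_of_ne (hh0 _) (Ne.symm hu0)
      positivity
  set X1 := ∫ v : V, b v ^ p ∂(Measure.addHaar : Measure V)
  set H1 := ∫ u, h u ^ p
  set X2 := ∫ v : V, ‖fderiv ℝ b v‖ ^ p ∂(Measure.addHaar : Measure V)
  set H2 := ∫ u, |deriv h u| ^ p
  -- the three product functions
  have hzpos : ∀ x ∈ U, ‖z x‖ ≠ 0 := fun x hx => norm_ne_zero_iff.2 hx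
  have cz : ∀ r : ℝ, ContinuousOn (fun x => ‖z x‖ ^ r) U := fun r =>
    hzc.norm.continuousOn.rpow_const (fun x hx => Or.inl (hzpos x hx))
  have clog : ContinuousOn (fun x => ε * Real.log ‖z x‖) U :=
    continuousOn_const.mul (hzc.norm.continuousOn.log hzpos)
  have prod_int : ∀ (α : F → ℝ) (g : ℝ → ℝ), Continuous α → Continuous g → (∀ v, 2 < ‖v‖ → α v = 0) →
      (∀ u, u ∉ Icc u1 u2 → g u = 0) →
      Integrable (fun x => α (R⁻¹ • y x) * (‖z x‖ ^ (-(m:ℝ)) * g (ε * Real.log ‖z x‖))) μ := by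
    intro α g hα hg hα0 hg0
    have := good_cont (f := fun x => α (R⁻¹ • y x) * (‖z x‖ ^ (-(m:ℝ)) * g (ε * Real.log ‖z x‖))) hUo
      (by
        apply ContinuousOn.mul
        · apply Continuous.continuousOn; fun_prop
        · exact (cz _).mul (hg.comp_continuousOn clog)) hSc hSU
      (by
        intro x hx
        rcases hA0 x hx with h1 | h1
        · rw [hα0 _ (hRv _ h1), zero_mul]
        · rw [hg0 _ (hlog _ (norm_nonneg _) h1)]; simp)
    exact this.1.integrable_of_hasCompactSupport this.2
  have cb : Continuous (fun v => b v ^ p) := hb.continuous.rpow_const (fun x => Or.inr hp0.le)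
  have cdb : Continuous (fun v => ‖fderiv ℝ b v‖ ^ p) :=
    (hb.continuous_fderiv (by simp)).norm.rpow_const (fun x => Or.inr hp0.le)
  have ch : Continuous (fun u => h u ^ p) := hh.continuous.rpow_const (fun x => Or.inr hp0.le)
  have cdh : Continuous (fun u => |deriv h u| ^ p) :=
    (hh.continuous_deriv (by simp)).abs.rpow_const (fun x => Or.inr hp0.le)
  have J11 := prod_int _ _ cb ch (fun v hv => by rw [hbs v hv, z0]) (fun u hu => by rw [hhs u hu, z0])
  have J12 := prod_int _ _ cb cdh (fun v hv => by rw [hbs v hv, z0]) (fun u hu => by rw [hd0 u hu, abs_zero, z0])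
  have J21 := prod_int _ _ cdb ch (fun v hv => by rw [hdb0 v hv, norm_zero, z0]) (fun u hu => by rw [hhs u hu, z0])
  have I11 := hI (fun v => b v ^ p) (fun u => h u ^ p)
  have I12 := hI (fun v => b v ^ p) (fun u => |deriv h u| ^ p)
  have I21 := hI (fun v => ‖fderiv ℝ b v‖ ^ p) (fun u => h u ^ p)
  set M := κ * R ^ k * ε⁻¹
  have hM : 0 < M := by positivity
  have hexp : ∀ s : ℝ, 0 < s → s ^ σ * (s ^ (-C - 1)) ^ p = s ^ (-(m:ℝ)) := by
    intro s hs
    rw [← Real.rpow_mul hs.le, ← Real.rpow_add hs]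
    congr 1; linarith
  have hexp2 : ∀ s : ℝ, 0 < s → s ^ (-p) * (s ^ σ * (s ^ (-C)) ^ p) = s ^ (-(m:ℝ)) := by
    intro s hs
    rw [← Real.rpow_mul hs.le, ← Real.rpow_add hs, ← Real.rpow_add hs]
    congr 1; linarith
  have hexp3 : ∀ s : ℝ, 0 < s → s ^ σ * (s ^ (-C)) ^ p = s ^ p * s ^ (-(m:ℝ)) := by
    intro s hs
    rw [← Real.rpow_mul hs.le, ← Real.rpow_add hs, ← Real.rpow_add hs]
    congr 1; linarith
  have hφnn : ∀ x, 0 ≤ φ x := fun x => by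
    have := hb0 (R⁻¹ • y x); have := hh0 (ε * Real.log ‖z x‖)
    simp only [hφ, hf]; positivity
  -- denominator
  have den : θ * (M * X1 * H1) ≤ ∫ x, c ‖z x‖ * ‖z x‖ ^ (-p) * |φ x| ^ p ∂μ := by
    rw [← I11, ← integral_const_mul]
    have hcU : ContinuousOn (fun x => c ‖z x‖ * ‖z x‖ ^ (-p)) U := by
      apply ContinuousOn.mul _ (cz _)
      apply hc.comp hzc.norm.continuousOn
      intro x hx; exact norm_pos_iff.2 hx
    have g := good_cont (f := fun x => c ‖z x‖ * ‖z x‖ ^ (-p) * |φ x| ^ p) hUo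
      (hcU.mul (hφC.continuous.abs.rpow_const (fun x => Or.inr hp0.le)).continuousOn) hSc hSU
      (fun x hx => by rw [hφ0 x hx, abs_zero, z0, mul_zero])
    apply integral_mono (J11.const_mul _) (g.1.integrable_of_hasCompactSupport g.2)
    intro x
    by_cases hx : x ∈ S
    · have hpos : 0 < ‖z x‖ := norm_pos_iff.2 (hSU hx)
      have e1 := hc1 _ hpos hx.2.1 hx.2.2
      simp only
      rw [abs_of_nonneg (hφnn x)]
      simp only [hφ, hf]
      rw [Real.mul_rpow (hb0 _) (mul_nonneg (by positivity) (hh0 _)), Real.mul_rpow (by positivity) (hh0 _)]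
      rw [← hexp2 _ hpos]
      have t : 0 ≤ ‖z x‖ ^ (-p) * (b (R⁻¹ • y x) ^ p * ((‖z x‖ ^ (-C)) ^ p * h (ε * Real.log ‖z x‖) ^ p)) := by
        have := hb0 (R⁻¹ • y x); have := hh0 (ε * Real.log ‖z x‖)
        positivity
      calc _ = θ * ‖z x‖ ^ σ * (‖z x‖ ^ (-p) * (b (R⁻¹ • y x) ^ p * ((‖z x‖ ^ (-C)) ^ p * h (ε * Real.log ‖z x‖) ^ p))) := by ring
        _ ≤ _ := mul_le_mul_of_nonneg_right e1 t
        _ = _ := by ring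
    · simp only
      rw [hφ0 x hx, abs_zero, z0, mul_zero]
      rcases hA0 x hx with h1 | h1
      · rw [hbs _ (hRv _ h1), z0]; simp
      · rw [hhs _ (hlog _ (norm_nonneg _) h1), z0]; simp
  set l' := l ^ (1 - p) with hl'
  set m' := (1 - l) ^ (1 - p) with hm'
  have hl'0 : 0 ≤ l' := by positivity
  have hm'0 : 0 ≤ m' := Real.rpow_nonneg (by linarith) _
  have num : ∫ x, c ‖z x‖ * ‖gradient φ x‖ ^ p ∂μ ≤
      Θ * (l' * (l' * C ^ p * (M * X1 * H1) + m' * ε ^ p * (M * X1 * H2)) + m' * (R⁻¹ ^ p * s2 ^ p) * (M * X2 * H1)) := by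
    have cc := comb_int Θ l' (l' * C ^ p) (m' * ε ^ p) (m' * (R⁻¹ ^ p * s2 ^ p)) J11 J12 J21
    rw [← I11, ← I12, ← I21, ← cc.2]
    apply integral_mono_of_nonneg
    · filter_upwards with x
      exact mul_nonneg (hc0 _ (norm_nonneg _)) (by positivity)
    · exact cc.1
    · filter_upwards with x
      have n1 := hb0 (R⁻¹ • y x)
      have n2 := hh0 (ε * Real.log ‖z x‖)
      simp only [hgr]
      by_cases hx : x ∈ S
      · have hpos : 0 < ‖z x‖ := norm_pos_iff.2 (hSU hx)
        have e1 := hc2 _ hpos hx.2.1 hx.2.2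
        have e2 := Real.rpow_le_rpow (norm_nonneg _) (grad_bd x hx) hp0.le
        set s := ‖z x‖
        set B := b (R⁻¹ • y x)
        set B' := ‖fderiv ℝ b (R⁻¹ • y x)‖
        set hv := h (ε * Real.log s)
        set dv := |deriv h (ε * Real.log s)|
        have hB' : 0 ≤ B' := norm_nonneg _
        have hdv : 0 ≤ dv := abs_nonneg _
        have hfs : f s = s ^ (-C) * hv := rfl
        have e3 : ‖fderiv ℝ φ x‖ ^ p ≤ l' * (B ^ p * ((s ^ (-C - 1)) ^ p * (l' * (C ^ p * hv ^ p) + m' * (ε ^ p * dv ^ p))))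
            + m' * (R⁻¹ ^ p * B' ^ p * ((s ^ (-C)) ^ p * hv ^ p)) := by
          refine e2.trans ?_
          refine (add_rpow_split p l _ _ hp.le hl hl1 (by positivity) (by rw [hfs]; positivity)).trans ?_
          have e4 := add_rpow_split p l (C * hv) (ε * dv) hp.le hl hl1 (by positivity) (by positivity)
          rw [Real.mul_rpow hC0.le n2, Real.mul_rpow hε.le hdv] at e4
          rw [hfs, Real.mul_rpow n1 (by positivity), Real.mul_rpow (by positivity) (by positivity),
            Real.mul_rpow (by positivity) (by positivity), Real.mul_rpow (by positivity) hB',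
            Real.mul_rpow (by positivity) n2]
          gcongr
        have e5 : 0 ≤ ‖fderiv ℝ φ x‖ ^ p := by positivity
        have e6 : s ^ p ≤ s2 ^ p := Real.rpow_le_rpow hpos.le hx.2.2 hp0.le
        calc c s * ‖fderiv ℝ φ x‖ ^ p ≤ Θ * s ^ σ * ‖fderiv ℝ φ x‖ ^ p := mul_le_mul_of_nonneg_right e1 e5
          _ ≤ Θ * s ^ σ * (l' * (B ^ p * ((s ^ (-C - 1)) ^ p * (l' * (C ^ p * hv ^ p) + m' * (ε ^ p * dv ^ p))))
            + m' * (R⁻¹ ^ p * B' ^ p * ((s ^ (-C)) ^ p * hv ^ p))) := by gcongr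
          _ = Θ * (l' * (B ^ p * ((s ^ σ * (s ^ (-C - 1)) ^ p) * (l' * (C ^ p * hv ^ p) + m' * (ε ^ p * dv ^ p))))
            + m' * (R⁻¹ ^ p * B' ^ p * ((s ^ σ * (s ^ (-C)) ^ p) * hv ^ p))) := by ring
          _ = Θ * (l' * (B ^ p * (s ^ (-(m:ℝ)) * (l' * (C ^ p * hv ^ p) + m' * (ε ^ p * dv ^ p))))
            + m' * (R⁻¹ ^ p * B' ^ p * ((s ^ p * s ^ (-(m:ℝ))) * hv ^ p))) := by rw [hexp s hpos, hexp3 s hpos]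
          _ ≤ Θ * (l' * (B ^ p * (s ^ (-(m:ℝ)) * (l' * (C ^ p * hv ^ p) + m' * (ε ^ p * dv ^ p))))
            + m' * (R⁻¹ ^ p * B' ^ p * ((s2 ^ p * s ^ (-(m:ℝ))) * hv ^ p))) := by gcongr
          _ = _ := by ring
      · rw [hfd0 x hx, norm_zero, z0, mul_zero]
        positivity
  have hden0 : 0 < ∫ x, c ‖z x‖ * ‖z x‖ ^ (-p) * |φ x| ^ p ∂μ := lt_of_lt_of_le (by positivity) den
  refine ⟨φ, hφC, HasCompactSupport.intro hSc hφ0, ?_, ?_, hden0, ?_⟩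
  · intro x hx
    exact ⟨(hts hx).1, norm_pos_iff.2 (hSU (hts hx))⟩
  · intro h0
    rw [h0] at hden0
    simp [z0] at hden0
  · refine num.trans ?_
    have hX2 : 0 ≤ X2 := integral_nonneg (fun v => by positivity)
    have hH2 : 0 ≤ H2 := integral_nonneg (fun v => by positivity)
    have e7 : (s2 / R) ^ p = R⁻¹ ^ p * s2 ^ p := by
      rw [div_eq_inv_mul, Real.mul_rpow (by positivity) (by positivity)]
    rw [e7]
    have hCp : 0 ≤ C ^ p := by positivity
    have e8 : Θ * (l' * (l' * C ^ p * (M * X1 * H1) + m' * ε ^ p * (M * X1 * H2)) + m' * (R⁻¹ ^ p * s2 ^ p) * (M * X2 * H1))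
      = (Θ / θ * (l' * (l' * C ^ p + m' * ε ^ p * (H2 / H1)) + m' * (R⁻¹ ^ p * s2 ^ p) * (X2 / X1))) * (θ * (M * X1 * H1)) := by
      field_simp
    rw [e8]
    apply mul_le_mul_of_nonneg_left den
    positivity

end upper

section final

theorem grad_zero {F : Type*} [NormedAddCommGroup F] [InnerProductSpace ℝ F] [CompleteSpace F]
    {φ : F → ℝ} {x : F} (hx : x ∉ tsupport φ) : gradient φ x = 0 := by
  unfold gradient
  have : fderiv ℝ φ x = 0 := by
    by_contra hc
    exact hx (support_fderiv_subset ℝ hc)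
  rw [this, map_zero]

theorem num_full {d : ℕ} (p δ δ' : ℝ) (hp : 0 < p) (L : Set (EuclideanSpace ℝ (Fin d)))
    {φ : EuclideanSpace ℝ (Fin d) → ℝ} (hs : tsupport φ ⊆ Lᶜ) :
    (∫ x in Lᶜ, (Metric.infDist x L ^ δ * (1 + Metric.infDist x L) ^ (δ' - δ)) * ‖gradient φ x‖ ^ p) =
    ∫ x, (Metric.infDist x L ^ δ * (1 + Metric.infDist x L) ^ (δ' - δ)) * ‖gradient φ x‖ ^ p := by
  apply setIntegral_eq_integral_of_forall_compl_eq_zero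
  intro x hx
  rw [grad_zero (fun h => hx (hs h)), norm_zero, Real.zero_rpow hp.ne', mul_zero]

theorem den_full {d : ℕ} (p δ δ' : ℝ) (hp : 0 < p) (L : Set (EuclideanSpace ℝ (Fin d)))
    {φ : EuclideanSpace ℝ (Fin d) → ℝ} (hs : tsupport φ ⊆ Lᶜ) :
    (∫ x in Lᶜ, (Metric.infDist x L ^ δ * (1 + Metric.infDist x L) ^ (δ' - δ)) *
            Metric.infDist x L ^ (-p) * |φ x| ^ p) =
    ∫ x, WW p δ δ' L x * |φ x| ^ p := by
  unfold WW
  apply setIntegral_eq_integral_of_forall_compl_eq_zero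
  intro x hx
  rw [image_eq_zero_of_notMem_tsupport (fun h => hx (hs h)), abs_zero, Real.zero_rpow hp.ne', mul_zero]

theorem muP_le {d : ℕ} (p δ δ' : ℝ) (hp : 0 < p) (L : Set (EuclideanSpace ℝ (Fin d)))
    (φ : EuclideanSpace ℝ (Fin d) → ℝ) (h1 : ContDiff ℝ 1 φ) (hc : HasCompactSupport φ)
    (hs : tsupport φ ⊆ Lᶜ) (h0 : φ ≠ 0) (B : ℝ) (hD : 0 < ∫ x, WW p δ δ' L x * |φ x| ^ p)
    (hN : ∫ x, (Metric.infDist x L ^ δ * (1 + Metric.infDist x L) ^ (δ' - δ)) * ‖gradient φ x‖ ^ p ≤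
      B * ∫ x, WW p δ δ' L x * |φ x| ^ p) : muP d p δ δ' L ≤ B := by
  have hin : muP d p δ δ' L ≤ (∫ x, (Metric.infDist x L ^ δ * (1 + Metric.infDist x L) ^ (δ' - δ)) * ‖gradient φ x‖ ^ p) /
      ∫ x, WW p δ δ' L x * |φ x| ^ p := by
    unfold muP
    apply csInf_le
    · refine ⟨0, ?_⟩
      rintro r ⟨ψ, -, -, -, -, rfl⟩
      apply div_nonneg <;> apply integral_nonneg <;> intro x <;>
        have := Metric.infDist_nonneg (x := x) (s := L) <;> simp only [Pi.zero_apply] <;> positivity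
    · refine ⟨φ, h1, hc, hs, h0, ?_⟩
      rw [num_full p δ δ' hp L hs, den_full p δ δ' hp L hs]
  refine hin.trans ?_
  rwa [div_le_iff₀ hD]

theorem muP_lower {d : ℕ} (K : Set (EuclideanSpace ℝ (Fin d))) (hne : K.Nonempty) (hcl : IsClosed K)
    (hconv : Convex ℝ K) (hK : K ≠ univ) (V : Submodule ℝ (EuclideanSpace ℝ (Fin d)))
    (hV : ∀ x ∈ K, ∀ y ∈ K, x - y ∈ V)
    (p δ δ' C : ℝ) (hp : 1 < p) (hC : C * p = Module.finrank ℝ Vᗮ + min δ δ' - p) (hC0 : 0 < C) :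
    C ^ p ≤ muP d p δ δ' K := by
  have hp0 : 0 < p := by linarith
  obtain ⟨P, hP⟩ := exists_isProj K hne hcl hconv
  unfold muP
  apply le_csInf
  · obtain ⟨a, ha⟩ := (ne_univ_iff_exists_notMem K).1 hK
    obtain ⟨r, hr, hrb⟩ := Metric.isOpen_iff.1 hcl.isOpen_compl a ha
    let b : ContDiffBump a := ⟨r/4, r/2, by positivity, by linarith⟩
    refine ⟨_, b, b.contDiff, b.hasCompactSupport, ?_, ?_, rfl⟩
    · rw [b.tsupport_eq]
      exact (Metric.closedBall_subset_ball (by show r/2 < r; linarith)).trans hrb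
    · intro h
      have h2 : b a = 1 := b.one_of_mem_closedBall (Metric.mem_closedBall_self b.rIn_pos.le)
      rw [h] at h2
      simp at h2
  · rintro r ⟨φ, h1, hc, hs, h0, rfl⟩
    rw [num_full p δ δ' hp0 K hs, den_full p δ δ' hp0 K hs]
    have z0 : (0:ℝ) ^ p = 0 := Real.zero_rpow hp0.ne'
    have g := good_mul hcl (WW_cont p δ δ' hne hcl)
      (h1.continuous.abs.rpow_const (fun x => Or.inr hp0.le)) hc.isCompact hs
      (fun x hx => by rw [image_eq_zero_of_notMem_tsupport hx, abs_zero, z0])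
    obtain ⟨x, hx⟩ := Function.ne_iff.1 h0
    have hD : 0 < ∫ x, WW p δ δ' K x * |φ x| ^ p := by
      apply Continuous.integral_pos_of_hasCompactSupport_nonneg_nonzero (x := x) g.1 g.2
      · intro x
        exact mul_nonneg (WW_nonneg _ _ _ _ _) (by positivity)
      · have hxK : x ∉ K := hs (subset_tsupport _ hx)
        have := WW_pos p δ δ' hne hcl hxK
        have : 0 < |φ x| := abs_pos.2 hx
        positivity
    rw [le_div_iff₀ hD]
    exact hardy_lower volume hcl hne hP V hV p δ δ' C hp hC hC0 φ h1 hc hs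

/-- weight as function of distance -/
def cw (δ δ' s : ℝ) : ℝ := s ^ δ * (1 + s) ^ (δ' - δ)

theorem muP_upper_one {d : ℕ} (L : Set (EuclideanSpace ℝ (Fin d)))
    (V : Submodule ℝ (EuclideanSpace ℝ (Fin d))) [Nontrivial Vᗮ] (x0 : EuclideanSpace ℝ (Fin d))
    (u0 u1 u2 : ℝ) (h : ℝ → ℝ) (hh : ContDiff ℝ 1 h) (hh0 : ∀ u, 0 ≤ h u) (hu0 : h u0 ≠ 0)
    (hhs : ∀ u, u ∉ Icc u1 u2 → h u = 0) (h00 : (0:ℝ) ∉ Icc u1 u2)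
    (p δ δ' σ C : ℝ) (hp : 1 < p) (hC : C * p = Module.finrank ℝ Vᗮ + σ - p) (hC0 : 0 < C) :
    ∃ D1 D2 : ℝ, ∀ ε R l θ Θ : ℝ, 0 < ε → 0 < R → 0 < l → l < 1 → 0 < θ → 0 ≤ Θ →
    (∀ s, 0 < s → Real.exp (u1 / ε) ≤ s → s ≤ Real.exp (u2 / ε) → θ * s ^ σ ≤ cw δ δ' s) →
    (∀ s, 0 < s → Real.exp (u1 / ε) ≤ s → s ≤ Real.exp (u2 / ε) → cw δ δ' s ≤ Θ * s ^ σ) →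
    (∀ x, ‖V.starProjection (x - x0)‖ ≤ 2 * R → Metric.infDist x L = ‖Vᗮ.starProjection (x - x0)‖) →
    muP d p δ δ' L ≤ Θ / θ * (l ^ (1 - p) * (l ^ (1 - p) * C ^ p + (1 - l) ^ (1 - p) * ε ^ p * D1)
          + (1 - l) ^ (1 - p) * (Real.exp (u2 / ε) / R) ^ p * D2) := by
  have hp0 : 0 < p := by linarith
  have z0 : (0:ℝ) ^ p = 0 := Real.zero_rpow hp0.ne'
  let b : ContDiffBump (0 : EuclideanSpace ℝ (Fin d)) := ⟨1, 2, by norm_num, by norm_num⟩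
  refine ⟨(∫ u, |deriv h u| ^ p) / (∫ u, h u ^ p),
    (∫ v : V, ‖fderiv ℝ b v‖ ^ p ∂(Measure.addHaar : Measure V)) / (∫ v : V, b v ^ p ∂(Measure.addHaar : Measure V)),
    fun ε R l θ Θ hε hR hl hl1 hθ hΘ hc1 hc2 hL => ?_⟩
  · obtain ⟨φ, f1, f2, f3, f4, f5, f6⟩ := upper_test volume V x0 b b.contDiff (fun x => b.nonneg)
      (by rw [b.one_of_mem_closedBall (Metric.mem_closedBall_self b.rIn_pos.le)]; norm_num)
      (fun x hx => b.zero_of_le_dist (by rw [dist_zero_right]; exact hx.le))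
      h hh hh0 u0 u1 u2 hu0 hhs h00 ε R l p σ C θ Θ hε hR hl hl1 hp (cw δ δ')
      (by
        unfold cw
        intro s hs
        have hs : 0 < s := hs
        apply ContinuousAt.continuousWithinAt
        exact (Real.continuousAt_rpow_const _ _ (Or.inl hs.ne')).mul
          (ContinuousAt.rpow_const (by fun_prop) (Or.inl (by positivity))))
      (fun s hs => by unfold cw; positivity) hθ hΘ hc1 hc2 hC hC0
    have hsup : tsupport φ ⊆ Lᶜ := by
      intro x hx hxL
      have := hL x (f3 x hx).1
      rw [Metric.infDist_zero_of_mem hxL] at this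
      exact (f3 x hx).2.ne this
    have e1 : ∫ x, cw δ δ' ‖Vᗮ.starProjection (x - x0)‖ * ‖Vᗮ.starProjection (x - x0)‖ ^ (-p) * |φ x| ^ p
        = ∫ x, WW p δ δ' L x * |φ x| ^ p := by
      congr 1; ext x
      by_cases hx : x ∈ tsupport φ
      · rw [WW, hL x (f3 x hx).1, cw]
      · rw [image_eq_zero_of_notMem_tsupport hx, abs_zero, z0, mul_zero, mul_zero]
    have e2 : ∫ x, cw δ δ' ‖Vᗮ.starProjection (x - x0)‖ * ‖gradient φ x‖ ^ p
        = ∫ x, (Metric.infDist x L ^ δ * (1 + Metric.infDist x L) ^ (δ' - δ)) * ‖gradient φ x‖ ^ p := by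
      congr 1; ext x
      by_cases hx : x ∈ tsupport φ
      · rw [hL x (f3 x hx).1, cw]
      · rw [grad_zero hx, norm_zero, z0, mul_zero, mul_zero]
    rw [e1] at f5
    rw [e1, e2] at f6
    exact muP_le p δ δ' hp0 L φ f1 f2 hsup f4 _ f5 f6

theorem lim_lem (X Y D1 D2 p : ℝ) (hp : 1 < p) (e q w : ℕ → ℝ) (he : Tendsto e atTop (𝓝 0))
    (hq : Tendsto q atTop (𝓝 1)) (hw : Tendsto w atTop (𝓝 0))
    (H : ∀ n l, 0 < l → l < 1 → X ≤ q n * (l ^ (1 - p) * (l ^ (1 - p) * Y + (1 - l) ^ (1 - p) * e n ^ p * D1)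
          + (1 - l) ^ (1 - p) * w n ^ p * D2)) : X ≤ Y := by
  have hp0 : 0 < p := by linarith
  have z0 : (0:ℝ) ^ p = 0 := Real.zero_rpow hp0.ne'
  have h1 : ∀ l : ℝ, 0 < l → l < 1 → X ≤ l ^ (1 - p) * (l ^ (1 - p) * Y) := by
    intro l hl hl1
    refine ge_of_tendsto' (x := atTop) ?_ (fun n => H n l hl hl1)
    have he' := he.rpow_const (p := p) (Or.inr hp0.le)
    have hw' := hw.rpow_const (p := p) (Or.inr hp0.le)
    rw [z0] at he' hw'
    have := hq.mul ((((he'.const_mul ((1 - l) ^ (1 - p))).mul_const D1).const_add (l ^ (1 - p) * Y)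
      |>.const_mul (l ^ (1 - p))).add ((hw'.const_mul ((1 - l) ^ (1 - p))).mul_const D2))
    simpa using this
  have h2 : Tendsto (fun l : ℝ => l ^ (1 - p) * (l ^ (1 - p) * Y)) (𝓝[<] 1) (𝓝 Y) := by
    have h3 : Tendsto (fun l : ℝ => l ^ (1 - p)) (𝓝[<] 1) (𝓝 1) := by
      have := (Real.continuousAt_rpow_const 1 (1 - p) (Or.inl one_ne_zero)).tendsto
      rw [Real.one_rpow] at this
      exact this.mono_left nhdsWithin_le_nhds
    simpa using h3.mul (h3.mul_const Y)
  refine ge_of_tendsto h2 ?_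
  filter_upwards [Ioo_mem_nhdsLT (show (0:ℝ) < 1 by norm_num)] with l hl
  exact h1 l hl.1 hl.2

theorem exp_lim : Tendsto (fun n : ℕ => Real.exp (-((n:ℝ) + 1))) atTop (𝓝 0) :=
  Real.tendsto_exp_neg_atTop_nhds_zero.comp
    (tendsto_atTop_add_const_right _ _ tendsto_natCast_atTop_atTop)

theorem rpow_exp_lim (r : ℝ) : Tendsto (fun n : ℕ => (1 + Real.exp (-((n:ℝ) + 1))) ^ r) atTop (𝓝 1) := by
  have := (exp_lim.const_add 1).rpow_const (p := r) (Or.inl (by norm_num))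
  simpa using this

theorem bump_h (c : ℝ) : ∃ h : ℝ → ℝ, ContDiff ℝ 1 h ∧ (∀ u, 0 ≤ h u) ∧ h c ≠ 0 ∧
    ∀ u, u ∉ Icc (c - 1/2) (c + 1/2) → h u = 0 := by
  let b : ContDiffBump c := ⟨1/4, 1/2, by norm_num, by norm_num⟩
  refine ⟨b, b.contDiff, fun x => b.nonneg, ?_, fun u hu => ?_⟩
  · rw [b.one_of_mem_closedBall (Metric.mem_closedBall_self b.rIn_pos.le)]; norm_num
  · apply b.zero_of_le_dist
    show 1/2 ≤ dist u c
    rw [Real.dist_eq]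
    by_contra hc
    push Not at hc
    rw [abs_lt] at hc
    exact hu ⟨by linarith, by linarith⟩

theorem muP_upper_near {d : ℕ} (L : Set (EuclideanSpace ℝ (Fin d)))
    (V : Submodule ℝ (EuclideanSpace ℝ (Fin d))) [Nontrivial Vᗮ] (x0 : EuclideanSpace ℝ (Fin d))
    (p δ δ' C : ℝ) (hp : 1 < p) (hδδ : δ ≤ δ')
    (hC : C * p = Module.finrank ℝ Vᗮ + δ - p) (hC0 : 0 < C) (ρ : ℝ) (hρ : 0 < ρ)
    (hL : ∀ x, ‖V.starProjection (x - x0)‖ ≤ ρ → Metric.infDist x L = ‖Vᗮ.starProjection (x - x0)‖) :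
    muP d p δ δ' L ≤ C ^ p := by
  obtain ⟨h, a1, a2, a3, a4⟩ := bump_h (-(3/2))
  obtain ⟨D1, D2, H⟩ := muP_upper_one L V x0 _ _ _ h a1 a2 a3 a4
    (by rintro ⟨-, h⟩; norm_num at h) p δ δ' δ C hp hC hC0
  have hu2 : ∀ n : ℕ, (-(3/2) + 1/2 : ℝ) / (1 / ((n:ℝ) + 1)) = -((n:ℝ) + 1) := fun n => by
    rw [div_div_eq_mul_div, div_one]; ring
  refine lim_lem _ _ D1 D2 p hp (fun n => 1 / ((n:ℝ) + 1))
    (fun n => (1 + Real.exp (-((n:ℝ) + 1))) ^ (δ' - δ) / 1)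
    (fun n => Real.exp (-((n:ℝ) + 1)) / (ρ / 2)) tendsto_one_div_add_atTop_nhds_zero_nat ?_ ?_ ?_
  · simpa using rpow_exp_lim (δ' - δ)
  · simpa using exp_lim.div_const (ρ / 2)
  · intro n l hl hl1
    have := H (1 / ((n:ℝ) + 1)) (ρ / 2) l 1 ((1 + Real.exp (-((n:ℝ) + 1))) ^ (δ' - δ)) (by positivity) (by positivity)
      hl hl1 one_pos (by positivity) ?_ ?_ ?_
    · rwa [hu2] at this
    · intro s hs _ _
      unfold cw
      rw [one_mul]
      have : 1 ≤ (1 + s) ^ (δ' - δ) := Real.one_le_rpow (by linarith) (by linarith)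
      exact le_mul_of_one_le_right (by positivity) this
    · intro s hs _ h2
      rw [hu2] at h2
      unfold cw
      rw [mul_comm]
      apply mul_le_mul_of_nonneg_right _ (by positivity)
      exact Real.rpow_le_rpow (by positivity) (by linarith) (by linarith)
    · intro x hx
      exact hL x (by linarith)

theorem muP_upper_far {d : ℕ} (L : Set (EuclideanSpace ℝ (Fin d)))
    (V : Submodule ℝ (EuclideanSpace ℝ (Fin d))) [Nontrivial Vᗮ] (x0 : EuclideanSpace ℝ (Fin d))
    (p δ δ' C : ℝ) (hp : 1 < p) (hδδ : δ' ≤ δ)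
    (hC : C * p = Module.finrank ℝ Vᗮ + δ' - p) (hC0 : 0 < C)
    (hL : ∀ x, Metric.infDist x L = ‖Vᗮ.starProjection (x - x0)‖) :
    muP d p δ δ' L ≤ C ^ p := by
  obtain ⟨h, a1, a2, a3, a4⟩ := bump_h (3/2)
  obtain ⟨D1, D2, H⟩ := muP_upper_one L V x0 _ _ _ h a1 a2 a3 a4
    (by rintro ⟨h, -⟩; norm_num at h) p δ δ' δ' C hp hC hC0
  have hu1 : ∀ n : ℕ, (3/2 - 1/2 : ℝ) / (1 / ((n:ℝ) + 1)) = ((n:ℝ) + 1) := fun n => by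
    rw [div_div_eq_mul_div, div_one]; ring
  have hu2 : ∀ n : ℕ, (3/2 + 1/2 : ℝ) / (1 / ((n:ℝ) + 1)) = 2 * ((n:ℝ) + 1) := fun n => by
    rw [div_div_eq_mul_div, div_one]; ring
  refine lim_lem _ _ D1 D2 p hp (fun n => 1 / ((n:ℝ) + 1))
    (fun n => 1 / (1 + Real.exp (-((n:ℝ) + 1))) ^ (δ' - δ))
    (fun n => Real.exp (-((n:ℝ) + 1))) tendsto_one_div_add_atTop_nhds_zero_nat ?_ exp_lim ?_
  · simpa using (rpow_exp_lim (δ' - δ)).inv₀ one_ne_zero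
  · intro n l hl hl1
    have key : ∀ s : ℝ, 0 < s → cw δ δ' s = (1 + s⁻¹) ^ (δ' - δ) * s ^ δ' := by
      intro s hs
      unfold cw
      have : 1 + s = s * (1 + s⁻¹) := by field_simp; ring
      rw [this, Real.mul_rpow hs.le (by positivity), ← mul_assoc, ← Real.rpow_add hs, mul_comm]
      congr 2; ring
    have := H (1 / ((n:ℝ) + 1)) (Real.exp (3 * ((n:ℝ) + 1))) l ((1 + Real.exp (-((n:ℝ) + 1))) ^ (δ' - δ)) 1
      (by positivity) (by positivity) hl hl1 (by positivity) (by positivity) ?_ ?_ ?_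
    · rw [hu2, ← Real.exp_sub] at this
      convert this using 6
      ring
    · intro s hs h1 _
      rw [hu1] at h1
      rw [key s hs]
      apply mul_le_mul_of_nonneg_right _ (by positivity)
      apply Real.rpow_le_rpow_of_nonpos (by positivity) _ (by linarith)
      rw [Real.exp_neg]
      have := inv_anti₀ (Real.exp_pos _) h1
      linarith
    · intro s hs _ _
      rw [key s hs]
      apply mul_le_mul_of_nonneg_right _ (by positivity)
      apply Real.rpow_le_one_of_one_le_of_nonpos _ (by linarith)
      have : 0 < s⁻¹ := by positivity
      linarith
    · intro x _
      exact hL x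

theorem infDist_aff {F : Type*} [NormedAddCommGroup F] [InnerProductSpace ℝ F] [FiniteDimensional ℝ F]
    (L : Set F) (V : Submodule ℝ F) (x0 : F) (hLV : ∀ y ∈ L, y - x0 ∈ V) (x : F)
    (hx : x0 + V.starProjection (x - x0) ∈ L) : Metric.infDist x L = ‖Vᗮ.starProjection (x - x0)‖ := by
  have hd : x - x0 = V.starProjection (x - x0) + Vᗮ.starProjection (x - x0) :=
    (V.starProjection_add_starProjection_orthogonal (x - x0)).symm
  apply le_antisymm
  · refine (Metric.infDist_le_dist_of_mem hx).trans (le_of_eq ?_)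
    rw [dist_eq_norm]
    congr 1
    rw [← sub_sub]
    nth_rewrite 1 [hd]
    abel
  · apply (Metric.le_infDist ⟨_, hx⟩).2
    intro y hy
    rw [dist_eq_norm]
    have h1 : Vᗮ.starProjection (x - y) = Vᗮ.starProjection (x - x0) := by
      have h2 : Vᗮ.starProjection (y - x0) = 0 := by
        rw [Submodule.starProjection_apply_eq_zero_iff]
        rw [Submodule.orthogonal_orthogonal]
        exact hLV y hy
      have : x - y = (x - x0) - (y - x0) := by abel
      rw [this, map_sub, h2, sub_zero]
    rw [← h1]
    exact Submodule.norm_starProjection_apply_le _ _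

theorem final_thm
    (d k : ℕ) (hd : 1 ≤ d) (K : Set (EuclideanSpace ℝ (Fin d)))
    (hKne : K.Nonempty) (hKcl : IsClosed K) (hKconv : Convex ℝ K)
    (hKproper : K ≠ Set.univ)
    (hk : Module.finrank ℝ (affineSpan ℝ K).direction = k)
    (hk1 : 1 ≤ k) (hkd : k ≤ d - 1)
    (p δ δ' : ℝ) (hp : 1 < p) (hδ : 0 ≤ δ) (hδ' : 0 ≤ δ')
    (hcond : 0 < (d : ℝ) - k + min δ δ' - p) :
    muP d p δ δ' ((affineSpan ℝ K : Set (EuclideanSpace ℝ (Fin d)))) ≤ muP d p δ δ' K ∧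
    (δ ≤ δ' →
      muP d p δ δ' ((affineSpan ℝ K : Set (EuclideanSpace ℝ (Fin d)))) = muP d p δ δ' K) := by
  set A := affineSpan ℝ K with hA
  set V := A.direction with hV
  have hp0 : 0 < p := by linarith
  have hfr : (Module.finrank ℝ Vᗮ : ℝ) = (d:ℝ) - k := by
    have := Submodule.finrank_add_finrank_orthogonal V
    rw [hk, finrank_euclideanSpace_fin] at this
    have h2 : (k:ℝ) + (Module.finrank ℝ Vᗮ : ℝ) = d := by exact_mod_cast this
    linarith
  have hfr1 : 0 < Module.finrank ℝ Vᗮ := by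
    have h1 : (k:ℝ) < d := by exact_mod_cast (by omega : k < d)
    have : (0:ℝ) < Module.finrank ℝ Vᗮ := by rw [hfr]; linarith
    exact_mod_cast this
  have : Nontrivial Vᗮ := Module.finrank_pos_iff.1 hfr1
  set C := ((d : ℝ) - k + min δ δ' - p) / p with hCdef
  have hC : C * p = Module.finrank ℝ Vᗮ + min δ δ' - p := by
    rw [hfr, hCdef]; field_simp
  have hC0 : 0 < C := by positivity
  have hKA : K ⊆ A := subset_affineSpan ℝ K
  have hsub : ∀ x ∈ A, ∀ y ∈ A, x - y ∈ V := fun x hx y hy => AffineSubspace.vsub_mem_direction hx hy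
  have hadd : ∀ x ∈ A, ∀ v ∈ V, x + v ∈ A := fun x hx v hv => by
    rw [add_comm]; exact AffineSubspace.vadd_mem_of_mem_direction hv hx
  have hAne : (A : Set (EuclideanSpace ℝ (Fin d))).Nonempty := hKne.mono hKA
  have hAuniv : (A : Set (EuclideanSpace ℝ (Fin d))) ≠ univ := by
    intro h
    obtain ⟨v, hv⟩ := exists_ne (0 : Vᗮ)
    obtain ⟨x, hx⟩ := hAne
    have h1 : x + v ∈ (A : Set (EuclideanSpace ℝ (Fin d))) := by rw [h]; trivial
    have h2 := hsub _ h1 _ hx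
    rw [add_sub_cancel_left] at h2
    apply hv
    have h3 : inner ℝ (v : EuclideanSpace ℝ (Fin d)) v = 0 := v.2 _ h2
    exact Subtype.ext (inner_self_eq_zero.1 h3)
  have hKlow := muP_lower K hKne hKcl hKconv hKproper V
    (fun x hx y hy => hsub x (hKA hx) y (hKA hy)) p δ δ' C hp hC hC0
  have hAlow := muP_lower (A : Set (EuclideanSpace ℝ (Fin d))) hAne (AffineSubspace.closed_of_finiteDimensional A)
    A.convex hAuniv V hsub p δ δ' C hp hC hC0
  obtain ⟨x0, hx0⟩ : (intrinsicInterior ℝ K).Nonempty := hKne.intrinsicInterior hKconv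
  have hx0K : x0 ∈ K := intrinsicInterior_subset hx0
  have hx0A : x0 ∈ A := hKA hx0K
  have hAd : ∀ x, Metric.infDist x (A : Set (EuclideanSpace ℝ (Fin d))) = ‖Vᗮ.starProjection (x - x0)‖ := fun x =>
    infDist_aff _ V x0 (fun y hy => hsub y hy x0 hx0A) x
      (hadd x0 hx0A _ (Submodule.starProjection_apply_mem _ _))
  have hAup : muP d p δ δ' (A : Set (EuclideanSpace ℝ (Fin d))) ≤ C ^ p := by
    rcases le_total δ δ' with h | h
    · rw [min_eq_left h] at hC
      exact muP_upper_near _ V x0 p δ δ' C hp h hC hC0 1 one_pos (fun x _ => hAd x)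
    · rw [min_eq_right h] at hC
      exact muP_upper_far _ V x0 p δ δ' C hp h hC hC0 hAd
  refine ⟨hAup.trans hKlow, fun h => le_antisymm (hAup.trans hKlow) (le_trans ?_ hAlow)⟩
  rw [min_eq_left h] at hC
  rw [mem_intrinsicInterior] at hx0
  obtain ⟨q, hq, hqx⟩ := hx0
  obtain ⟨r, hr, hrb⟩ := Metric.mem_nhds_iff.1 (mem_interior_iff_mem_nhds.1 hq)
  refine muP_upper_near K V x0 p δ δ' C hp h hC hC0 (r / 2) (by positivity) (fun x hx => ?_)
  apply infDist_aff K V x0 (fun y hy => hsub y (hKA hy) x0 hx0A) x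
  have hmem := hadd x0 hx0A _ (Submodule.starProjection_apply_mem V (x - x0))
  have : (⟨_, hmem⟩ : A) ∈ Metric.ball q r := by
    rw [Metric.mem_ball, Subtype.dist_eq, dist_eq_norm, hqx]
    simp only [add_sub_cancel_left]
    linarith
  exact hrb this

end final

end helpers

/-- Comparison of the optimal Hardy constants for the complement of `K` and of its
affine hull `A_K`, with equality for `δ ≤ δ'` (remark after Theorem 4.6 of the paper). -/
theorem hardy_constant_affine_hull_comparison
    (d k : ℕ) (hd : 1 ≤ d) (K : Set (EuclideanSpace ℝ (Fin d)))
    (hKne : K.Nonempty) (hKcl : IsClosed K) (hKconv : Convex ℝ K)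
    (hKproper : K ≠ Set.univ)
    (hk : Module.finrank ℝ (affineSpan ℝ K).direction = k)
    (hk1 : 1 ≤ k) (hkd : k ≤ d - 1)
    (p δ δ' : ℝ) (hp : 1 < p) (hδ : 0 ≤ δ) (hδ' : 0 ≤ δ')
    (hcond : 0 < (d : ℝ) - k + min δ δ' - p) :
    muP d p δ δ' ((affineSpan ℝ K : Set (EuclideanSpace ℝ (Fin d)))) ≤ muP d p δ δ' K ∧
    (δ ≤ δ' →
      muP d p δ δ' ((affineSpan ℝ K : Set (EuclideanSpace ℝ (Fin d)))) = muP d p δ δ' K) := by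
  exact final_thm d k hd K hKne hKcl hKconv hKproper hk hk1 hkd p δ δ' hp hδ hδ' hcond
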